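/- Let f ∈ Lip(α,p) with p > 1 and 0 < α < 1, and let (a_{n,k}) be a lower triangular matrix with a_{n,k} ≥ 0 for k ≤ n, a_{n,k} = 0 for k > n, and ∑_{k=0}^n a_{n,k} = 1 for all n. If the rows (a_{n,k})_{k=0}^n belong to AMDMS with a constant independent of n and (n+1)a_{n,0} = O(1), then ‖T_n(f) − f‖_{L^p} = O(n^{−α}). -/

import Mathlib

open MeasureTheory Finset Real

/-- The Dirichlet kernel `D_n(u) = 1/2 + ∑_{k=1}^n cos(k u)`. -/
noncomputable def dirichletKernel (n : ℕ) (u : ℝ) : ℝ :=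
  1 / 2 + ∑ k ∈ Finset.Icc 1 n, Real.cos (k * u)

/-- The `n`-th partial sum of the Fourier series of a `2π`-periodic function `f`,
`S_n(f;x) = (1/π) ∫_0^{2π} f(t) D_n(x - t) dt`. -/
noncomputable def partialFourierSum (f : ℝ → ℝ) (n : ℕ) (x : ℝ) : ℝ :=
  (1 / Real.pi) * ∫ t in (0 : ℝ)..(2 * Real.pi), f t * dirichletKernel n (x - t)

/-- The normalized `L^p` norm `‖f‖_{L^p} = ((1/2π) ∫_0^{2π} |f(x)|^p dx)^{1/p}`. -/
noncomputable def lpNorm (p : ℝ) (f : ℝ → ℝ) : ℝ :=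
  ((1 / (2 * Real.pi)) * ∫ x in (0 : ℝ)..(2 * Real.pi), |f x| ^ p) ^ (1 / p)

/-- The integral modulus of continuity
`ω_p(f;δ) = sup_{0<|h|≤δ} ((1/2π) ∫_0^{2π} |f(x+h) - f(x)|^p dx)^{1/p}`. -/
noncomputable def intModulus (p : ℝ) (f : ℝ → ℝ) (δ : ℝ) : ℝ :=
  sSup {y : ℝ | ∃ h : ℝ, 0 < |h| ∧ |h| ≤ δ ∧
    y = ((1 / (2 * Real.pi)) * ∫ x in (0 : ℝ)..(2 * Real.pi), |f (x + h) - f x| ^ p) ^ (1 / p)}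

/-- `f ∈ Lip(α,p)`: `f` is `2π`-periodic, belongs to `L^p[0,2π]`, and
`ω_p(f;δ) = O(δ^α)`. -/
def LipClass (α p : ℝ) (f : ℝ → ℝ) : Prop :=
  Function.Periodic f (2 * Real.pi) ∧
  IntervalIntegrable f MeasureTheory.volume 0 (2 * Real.pi) ∧
  IntervalIntegrable (fun x => |f x| ^ p) MeasureTheory.volume 0 (2 * Real.pi) ∧
  ∃ C : ℝ, 0 < C ∧ ∀ δ : ℝ, 0 < δ → intModulus p f δ ≤ C * δ ^ α

/-- The matrix transform `T_n(f;x) = ∑_{k=0}^n a_{n,k} S_k(f;x)`. -/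
noncomputable def matrixMeans (a : ℕ → ℕ → ℝ) (f : ℝ → ℝ) (n : ℕ) (x : ℝ) : ℝ :=
  ∑ k ∈ Finset.range (n + 1), a n k * partialFourierSum f k x

/-- `A_{n,m} = (1/(m+1)) ∑_{k=0}^m a_{n,k}`, the Cesàro mean of the `n`-th row. -/
noncomputable def rowMean (a : ℕ → ℕ → ℝ) (n m : ℕ) : ℝ :=
  (1 / ((m : ℝ) + 1)) * ∑ k ∈ Finset.range (m + 1), a n k

/-- The Riesz means `R_n(f;x) = (1/P_n) ∑_{k=0}^n p_k S_k(f;x)` with weights `w`. -/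
noncomputable def rieszMeans (w : ℕ → ℝ) (f : ℝ → ℝ) (n : ℕ) (x : ℝ) : ℝ :=
  (1 / (∑ k ∈ Finset.range (n + 1), w k)) *
    ∑ k ∈ Finset.range (n + 1), w k * partialFourierSum f k x

/-- The kernel `K_n(u) = ∑_{k=0}^n a_{n,k} sin((k+1/2)u)/(2 sin(u/2))`. -/
noncomputable def matrixKernel (a : ℕ → ℕ → ℝ) (n : ℕ) (u : ℝ) : ℝ :=
  ∑ k ∈ Finset.range (n + 1),
    a n k * (Real.sin (((k : ℝ) + 1 / 2) * u) / (2 * Real.sin (u / 2)))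

theorem exists_abs_im_rpow_le {p : ℝ} (hp : 1 < p) (hp2 : p ≤ 2) :
    ∃ A B : ℝ, 0 ≤ A ∧ 0 ≤ B ∧ ∀ z : ℂ, 0 < z.re →
      |z.im| ^ p ≤ A * z.re ^ p - B * (z ^ (p : ℂ)).re := by
  have hp0 : 0 < p := by linarith
  have hpi := Real.pi_pos
  set γ : ℝ := (π / (2 * p) + π / 2) / 2 with hγ
  have h1 : π / (2 * p) < π / 2 := by
    apply div_lt_div_of_pos_left hpi <;> linarith
  have h0 : 0 < π / (2 * p) := by positivity
  have hγ2 : γ < π / 2 := by linarith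
  have hγ0 : 0 < γ := by linarith
  have hpγ : π / 2 < p * γ := by
    have : p * (π / (2 * p)) = π / 2 := by field_simp
    nlinarith
  have hcosγ : 0 < Real.cos γ := Real.cos_pos_of_mem_Ioo ⟨by linarith, hγ2⟩
  have hcospγ : Real.cos (p * γ) < 0 := by
    apply Real.cos_neg_of_pi_div_two_lt_of_lt hpγ
    nlinarith
  set B : ℝ := 1 / (-Real.cos (p * γ)) with hB
  have hB0 : 0 < B := by rw [hB]; apply one_div_pos.mpr; linarith
  have hBc : B * (-Real.cos (p * γ)) = 1 := by
    rw [hB]; exact one_div_mul_cancel (neg_pos.mpr hcospγ).ne'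
  refine ⟨(1 + B) / Real.cos γ ^ p, B, by positivity, hB0.le, ?_⟩
  intro z hz
  have hz0 : z ≠ 0 := by rintro rfl; simp at hz
  have hn : 0 < ‖z‖ := norm_pos_iff.mpr hz0
  set φ := z.arg with hφ
  have hφ2 : |φ| < π / 2 := Complex.abs_arg_lt_pi_div_two_iff.mpr (Or.inl hz)
  have hre : z.re = ‖z‖ * Real.cos φ := (Complex.norm_mul_cos_arg z).symm
  have him : |z.im| ≤ ‖z‖ := Complex.abs_im_le_norm z
  have hpow : (z ^ (p : ℂ)).re = ‖z‖ ^ p * Real.cos (p * φ) := by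
    rw [Complex.cpow_ofReal_re, mul_comm p]
  have hcosφ : 0 < Real.cos φ := by
    apply Real.cos_pos_of_mem_Ioo
    constructor <;> linarith [abs_lt.mp hφ2]
  have key : 1 ≤ (1 + B) / Real.cos γ ^ p * Real.cos φ ^ p - B * Real.cos (p * φ) := by
    rcases le_total γ |φ| with h | h
    · have hc : Real.cos (p * φ) ≤ Real.cos (p * γ) := by
        rw [← Real.cos_abs (p * φ), abs_mul, abs_of_pos hp0]
        apply Real.cos_le_cos_of_nonneg_of_le_pi (by positivity)
        · nlinarith [abs_nonneg φ]
        · gcongr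
      have : 0 ≤ (1 + B) / Real.cos γ ^ p * Real.cos φ ^ p := by positivity
      nlinarith
    · have hc : Real.cos γ ≤ Real.cos φ := by
        rw [← Real.cos_abs φ]
        exact Real.cos_le_cos_of_nonneg_of_le_pi (abs_nonneg _) (by linarith) h
      have hcp : Real.cos γ ^ p ≤ Real.cos φ ^ p := by gcongr
      have hpos : 0 < Real.cos γ ^ p := by positivity
      have : 1 + B ≤ (1 + B) / Real.cos γ ^ p * Real.cos φ ^ p := by
        rw [div_mul_eq_mul_div, le_div_iff₀ hpos]
        gcongr
      nlinarith [Real.cos_le_one (p * φ)]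
  calc |z.im| ^ p ≤ ‖z‖ ^ p := by gcongr
    _ ≤ ‖z‖ ^ p * ((1 + B) / Real.cos γ ^ p * Real.cos φ ^ p - B * Real.cos (p * φ)) :=
      le_mul_of_one_le_right (by positivity) key
    _ = _ := by
      rw [hpow, hre, Real.mul_rpow hn.le hcosφ.le]; ring

/-- Calderón's form of M. Riesz's inequality. -/
theorem exists_integral_abs_im_rpow_le {p : ℝ} (hp : 1 < p) (hp2 : p ≤ 2) :
    ∃ A : ℝ, 0 ≤ A ∧ ∀ F : ℂ → ℂ, DifferentiableOn ℂ F (Metric.ball 0 1) →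
      (∀ z ∈ Metric.ball (0 : ℂ) 1, 0 < (F z).re) → (F 0).im = 0 →
      ∀ r : ℝ, 0 ≤ r → r < 1 →
        ∫ x in (0 : ℝ)..(2 * π), |(F (circleMap 0 r x)).im| ^ p ≤
          A * ∫ x in (0 : ℝ)..(2 * π), (F (circleMap 0 r x)).re ^ p := by
  obtain ⟨A, B, hA, hB, h⟩ := exists_abs_im_rpow_le hp hp2
  have hp0 : 0 < p := by linarith
  refine ⟨A, hA, fun F hF hre him r hr0 hr1 ↦ ?_⟩
  have hsub : Metric.closedBall (0 : ℂ) r ⊆ Metric.ball 0 1 :=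
    Metric.closedBall_subset_ball hr1
  have hmem (x : ℝ) : circleMap 0 r x ∈ Metric.ball (0 : ℂ) 1 :=
    hsub (circleMap_mem_closedBall 0 hr0 x)
  have hFc : Continuous fun x : ℝ ↦ F (circleMap 0 r x) :=
    hF.continuousOn.comp_continuous (continuous_circleMap 0 r) hmem
  have hG : DifferentiableOn ℂ (fun z ↦ F z ^ (p : ℂ)) (Metric.ball 0 1) := by
    intro z hz
    exact (hF z hz).cpow_const (Or.inl (hre z hz))
  have hGc : Continuous fun x : ℝ ↦ F (circleMap 0 r x) ^ (p : ℂ) :=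
    hG.continuousOn.comp_continuous (continuous_circleMap 0 r) hmem
  have hmv : Real.circleAverage (fun z ↦ F z ^ (p : ℂ)) 0 r = F 0 ^ (p : ℂ) := by
    apply DiffContOnCl.circleAverage
    rw [abs_of_nonneg hr0]
    exact (hG.mono ((closure_mono Metric.ball_subset_closedBall).trans
      (Metric.isClosed_closedBall.closure_eq.subset.trans hsub))).diffContOnCl
  have hmean : ∫ x in (0 : ℝ)..(2 * π), (F (circleMap 0 r x) ^ (p : ℂ)).re =
      2 * π * (F 0 ^ (p : ℂ)).re := by
    have : ∫ x in (0 : ℝ)..(2 * π), F (circleMap 0 r x) ^ (p : ℂ) =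
        (2 * π : ℝ) • F 0 ^ (p : ℂ) := by
      rw [← hmv, Real.circleAverage_def, smul_inv_smul₀ Real.two_pi_pos.ne']
    have h2 := Complex.reCLM.intervalIntegral_comp_comm
      (hGc.intervalIntegrable 0 (2 * π) (μ := volume))
    simp only [Complex.reCLM_apply] at h2
    rw [h2, this]; simp
  have hF0 : 0 ≤ (F 0 ^ (p : ℂ)).re := by
    have h0 := hre 0 (by simp)
    have : F 0 = (((F 0).re : ℝ) : ℂ) := by
      apply Complex.ext <;> simp [him]
    rw [this, ← Complex.ofReal_cpow h0.le, Complex.ofReal_re]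
    positivity
  have c1 : Continuous fun x : ℝ ↦ |(F (circleMap 0 r x)).im| ^ p :=
    ((Complex.continuous_im.comp hFc).abs).rpow_const fun _ ↦ Or.inr hp0.le
  have c2 : Continuous fun x : ℝ ↦ (F (circleMap 0 r x)).re ^ p :=
    (Complex.continuous_re.comp hFc).rpow_const fun _ ↦ Or.inr hp0.le
  have c3 : Continuous fun x : ℝ ↦ (F (circleMap 0 r x) ^ (p : ℂ)).re :=
    Complex.continuous_re.comp hGc
  calc ∫ x in (0 : ℝ)..(2 * π), |(F (circleMap 0 r x)).im| ^ p
      ≤ ∫ x in (0 : ℝ)..(2 * π), (A * (F (circleMap 0 r x)).re ^ p -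
          B * (F (circleMap 0 r x) ^ (p : ℂ)).re) := by
        apply intervalIntegral.integral_mono Real.two_pi_pos.le (c1.intervalIntegrable _ _)
          (((c2.const_mul A).sub (c3.const_mul B)).intervalIntegrable _ _)
        exact fun x ↦ h _ (hre _ (hmem x))
    _ = A * (∫ x in (0 : ℝ)..(2 * π), (F (circleMap 0 r x)).re ^ p) -
          B * (2 * π * (F 0 ^ (p : ℂ)).re) := by
        rw [intervalIntegral.integral_sub ((c2.const_mul A).intervalIntegrable _ _)
          ((c3.const_mul B).intervalIntegrable _ _), intervalIntegral.integral_const_mul,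
          intervalIntegral.integral_const_mul, hmean]
    _ ≤ _ := by
        have : 0 ≤ B * (2 * π * (F 0 ^ (p : ℂ)).re) := by positivity
        linarith

/-- Lebesgue measure on one period. -/
noncomputable abbrev periodMeasure : Measure ℝ := volume.restrict (Set.Ioc 0 (2 * π))

/-- The denominator common to the Poisson kernel and its conjugate. -/
noncomputable def poissonDenom (r θ : ℝ) : ℝ := 1 - 2 * r * Real.cos θ + r ^ 2

theorem poissonDenom_pos {r : ℝ} (hr0 : 0 ≤ r) (hr1 : r < 1) (θ : ℝ) : 0 < poissonDenom r θ := by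
  unfold poissonDenom
  nlinarith [Real.cos_le_one θ, sq_pos_of_pos (sub_pos.mpr hr1)]

/-- The Poisson kernel of the unit disc at radius `r`, in angular form. -/
noncomputable def poissonAngle (r θ : ℝ) : ℝ := (1 - r ^ 2) / poissonDenom r θ

/-- The conjugate Poisson kernel of the unit disc at radius `r`, in angular form. -/
noncomputable def conjPoisson (r θ : ℝ) : ℝ := 2 * r * Real.sin θ / poissonDenom r θ

theorem continuous_poissonDenom (r : ℝ) : Continuous (poissonDenom r) := by
  unfold poissonDenom; fun_prop

theorem continuous_poissonAngle {r : ℝ} (hr0 : 0 ≤ r) (hr1 : r < 1) :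
    Continuous (poissonAngle r) :=
  continuous_const.div (continuous_poissonDenom r) fun θ ↦ (poissonDenom_pos hr0 hr1 θ).ne'

theorem continuous_conjPoisson {r : ℝ} (hr0 : 0 ≤ r) (hr1 : r < 1) :
    Continuous (conjPoisson r) :=
  Continuous.div (by fun_prop) (continuous_poissonDenom r)
    fun θ ↦ (poissonDenom_pos hr0 hr1 θ).ne'

theorem poissonAngle_pos {r : ℝ} (hr0 : 0 ≤ r) (hr1 : r < 1) (θ : ℝ) : 0 < poissonAngle r θ :=
  div_pos (by nlinarith) (poissonDenom_pos hr0 hr1 θ)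

theorem herglotzRieszKernel_circleMap {r : ℝ} (hr0 : 0 ≤ r) (hr1 : r < 1) (x t : ℝ) :
    herglotzRieszKernel 0 (circleMap 0 r x) (circleMap 0 1 t) =
      (poissonAngle r (x - t) : ℂ) + conjPoisson r (x - t) * Complex.I := by
  have hd := poissonDenom_pos hr0 hr1 (x - t)
  have hne : circleMap 0 1 t - circleMap 0 r x ≠ 0 := by
    intro h
    have := congrArg norm (sub_eq_zero.mp h)
    simp [abs_of_nonneg hr0] at this
    linarith
  have hx := Real.sin_sq_add_cos_sq x
  have ht := Real.sin_sq_add_cos_sq t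
  rw [herglotzRieszKernel_def, sub_zero, sub_zero, div_eq_iff hne]
  unfold poissonAngle conjPoisson
  rw [Complex.ofReal_div, Complex.ofReal_div]
  have hdc : ((poissonDenom r (x - t) : ℝ) : ℂ) ≠ 0 := by exact_mod_cast hd.ne'
  field_simp
  unfold poissonDenom
  rw [Real.cos_sub, Real.sin_sub]
  apply Complex.ext
  · simp only [circleMap, Complex.add_re, Complex.mul_re, Complex.exp_ofReal_mul_I_re,
      Complex.exp_ofReal_mul_I_im, Complex.ofReal_re, Complex.ofReal_im, Complex.sub_re,
      Complex.add_im, Complex.mul_im, Complex.sub_im, Complex.I_re, Complex.I_im,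
      Complex.zero_re, Complex.zero_im]
    linear_combination (-2 * r * Real.cos x) * ht - 2 * r ^ 2 * Real.cos t * hx
  · simp only [circleMap, Complex.add_re, Complex.mul_re, Complex.exp_ofReal_mul_I_re,
      Complex.exp_ofReal_mul_I_im, Complex.ofReal_re, Complex.ofReal_im, Complex.sub_re,
      Complex.add_im, Complex.mul_im, Complex.sub_im, Complex.I_re, Complex.I_im,
      Complex.zero_re, Complex.zero_im]
    linear_combination (-2 * r * Real.sin x) * ht - 2 * r ^ 2 * Real.sin t * hx

/-- Functions on a period, transported to the unit circle. -/
noncomputable def onCircle (u : ℝ → ℝ) (z : ℂ) : ℂ :=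
  u (toIocMod Real.two_pi_pos 0 z.arg)

theorem onCircle_circleMap (u : ℝ → ℝ) {t : ℝ} (ht : t ∈ Set.Ioc 0 (2 * π)) :
    onCircle u (circleMap 0 1 t) = u t := by
  unfold onCircle
  congr 2
  have : (circleMap 0 1 t).arg = toIocMod Real.two_pi_pos (-π) t := by
    simp [circleMap, Complex.arg_exp_mul_I]
  rw [this, toIocMod_toIocMod]
  exact (toIocMod_eq_self _).mpr (by simpa using ht)

/-- The conjugate Poisson integral. -/
noncomputable def conjPoissonIntegral (r : ℝ) (u : ℝ → ℝ) (x : ℝ) : ℝ :=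
  (2 * π)⁻¹ * ∫ t in (0 : ℝ)..(2 * π), u t * conjPoisson r (x - t)

/-- The Poisson integral. -/
noncomputable def poissonIntegral (r : ℝ) (u : ℝ → ℝ) (x : ℝ) : ℝ :=
  (2 * π)⁻¹ * ∫ t in (0 : ℝ)..(2 * π), u t * poissonAngle r (x - t)

theorem IntervalIntegrable.complex_ofReal {u : ℝ → ℝ} {a b : ℝ}
    (hu : IntervalIntegrable u volume a b) :
    IntervalIntegrable (fun t ↦ (u t : ℂ)) volume a b :=
  ⟨hu.1.ofReal, hu.2.ofReal⟩

/-- The Herglotz transform of a function on a period. -/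
noncomputable def herglotz (u : ℝ → ℝ) (w : ℂ) : ℂ :=
  Real.circleAverage (fun ζ ↦ herglotzRieszKernel 0 w ζ • onCircle u ζ) 0 1

theorem herglotz_circleMap {u : ℝ → ℝ} (hu : IntervalIntegrable u volume 0 (2 * π))
    {r : ℝ} (hr0 : 0 ≤ r) (hr1 : r < 1) (x : ℝ) :
    herglotz u (circleMap 0 r x) =
      (poissonIntegral r u x : ℂ) + conjPoissonIntegral r u x * Complex.I := by
  have hP : IntervalIntegrable (fun t ↦ u t * poissonAngle r (x - t)) volume 0 (2 * π) :=
    hu.mul_continuousOn ((continuous_poissonAngle hr0 hr1).comp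
      (continuous_const.sub continuous_id)).continuousOn
  have hQ : IntervalIntegrable (fun t ↦ u t * conjPoisson r (x - t)) volume 0 (2 * π) :=
    hu.mul_continuousOn ((continuous_conjPoisson hr0 hr1).comp
      (continuous_const.sub continuous_id)).continuousOn
  have : ∫ t in (0 : ℝ)..(2 * π), herglotzRieszKernel 0 (circleMap 0 r x) (circleMap 0 1 t) •
      onCircle u (circleMap 0 1 t) =
      ∫ t in (0 : ℝ)..(2 * π), (((u t * poissonAngle r (x - t) : ℝ) : ℂ) +
        ((u t * conjPoisson r (x - t) : ℝ) : ℂ) * Complex.I) := by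
    apply intervalIntegral.integral_congr_ae
    refine Filter.Eventually.of_forall fun t ht ↦ ?_
    rw [Set.uIoc_of_le Real.two_pi_pos.le] at ht
    rw [onCircle_circleMap u ht, herglotzRieszKernel_circleMap hr0 hr1]
    push_cast
    simp only [smul_eq_mul]
    ring
  rw [herglotz, Real.circleAverage_def, this, intervalIntegral.integral_add hP.complex_ofReal
    (hQ.complex_ofReal.mul_const _), intervalIntegral.integral_mul_const,
    intervalIntegral.integral_ofReal, intervalIntegral.integral_ofReal,
    poissonIntegral, conjPoissonIntegral]
  rw [Complex.real_smul]
  push_cast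
  ring

theorem differentiableOn_herglotz {u : ℝ → ℝ} (hu : IntervalIntegrable u volume 0 (2 * π)) :
    DifferentiableOn ℂ (herglotz u) (Metric.ball 0 1) := by
  apply differentiableOn_circleAverage_herglotzRieszKernel_smul
  refine IntervalIntegrable.congr ?_ hu.complex_ofReal
  intro t ht
  rw [Set.uIoc_of_le Real.two_pi_pos.le] at ht
  exact (onCircle_circleMap u ht).symm

theorem poissonIntegral_pos {u : ℝ → ℝ} (hu : IntervalIntegrable u volume 0 (2 * π))
    (hu0 : ∀ t, 0 ≤ u t) (hpos : 0 < ∫ t in (0 : ℝ)..(2 * π), u t)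
    {r : ℝ} (hr0 : 0 ≤ r) (hr1 : r < 1) (x : ℝ) : 0 < poissonIntegral r u x := by
  have hP : IntervalIntegrable (fun t ↦ u t * poissonAngle r (x - t)) volume 0 (2 * π) :=
    hu.mul_continuousOn ((continuous_poissonAngle hr0 hr1).comp
      (continuous_const.sub continuous_id)).continuousOn
  apply mul_pos (inv_pos.mpr Real.two_pi_pos)
  have hbd (θ : ℝ) : (1 - r ^ 2) / (1 + r) ^ 2 ≤ poissonAngle r θ := by
    unfold poissonAngle
    apply div_le_div_of_nonneg_left (by nlinarith) (poissonDenom_pos hr0 hr1 θ)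
    unfold poissonDenom
    nlinarith [Real.neg_one_le_cos θ]
  have hc : 0 < (1 - r ^ 2) / (1 + r) ^ 2 := div_pos (by nlinarith) (by positivity)
  calc 0 < (∫ t in (0 : ℝ)..(2 * π), u t) * ((1 - r ^ 2) / (1 + r) ^ 2) := mul_pos hpos hc
    _ = ∫ t in (0 : ℝ)..(2 * π), u t * ((1 - r ^ 2) / (1 + r) ^ 2) :=
      (intervalIntegral.integral_mul_const _ _).symm
    _ ≤ _ := intervalIntegral.integral_mono Real.two_pi_pos.le (hu.mul_const _) hP
      fun t ↦ mul_le_mul_of_nonneg_left (hbd _) (hu0 t)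

theorem conjPoissonIntegral_radius_zero (u : ℝ → ℝ) (x : ℝ) : conjPoissonIntegral 0 u x = 0 := by
  simp [conjPoissonIntegral, conjPoisson]

theorem exists_integral_conjPoissonIntegral_le {p : ℝ} (hp : 1 < p) (hp2 : p ≤ 2) :
    ∃ A : ℝ, 0 ≤ A ∧ ∀ u : ℝ → ℝ, IntervalIntegrable u volume 0 (2 * π) → (∀ t, 0 ≤ u t) →
      ∀ r : ℝ, 0 ≤ r → r < 1 →
        ∫ x in (0 : ℝ)..(2 * π), |conjPoissonIntegral r u x| ^ p ≤
          A * ∫ x in (0 : ℝ)..(2 * π), poissonIntegral r u x ^ p := by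
  obtain ⟨A, hA, h⟩ := exists_integral_abs_im_rpow_le hp hp2
  refine ⟨A, hA, fun u hu hu0 r hr0 hr1 ↦ ?_⟩
  rcases (intervalIntegral.integral_nonneg (μ := volume) Real.two_pi_pos.le
    fun t _ ↦ hu0 t).eq_or_lt with h0 | hpos
  · have hae : u =ᵐ[periodMeasure] 0 := by
      rw [intervalIntegral.integral_of_le Real.two_pi_pos.le, eq_comm,
        setIntegral_eq_zero_iff_of_nonneg_ae (Filter.Eventually.of_forall hu0)
        ((intervalIntegrable_iff_integrableOn_Ioc_of_le Real.two_pi_pos.le).mp hu)] at h0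
      exact h0
    have hz (k : ℝ → ℝ) : ∫ t in (0 : ℝ)..(2 * π), u t * k t = 0 := by
      rw [intervalIntegral.integral_of_le Real.two_pi_pos.le]
      apply integral_eq_zero_of_ae
      filter_upwards [hae] with t ht
      simp [ht]
    have hp0 : p ≠ 0 := by linarith
    simp [conjPoissonIntegral, poissonIntegral, hz, hp0]
  · have hre : ∀ z ∈ Metric.ball (0 : ℂ) 1, 0 < (herglotz u z).re := by
      intro z hz
      have hz' : z = circleMap 0 ‖z‖ z.arg := by
        simp [circleMap]
      rw [hz', herglotz_circleMap hu (norm_nonneg z) (by simpa using hz)]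
      simpa using poissonIntegral_pos hu hu0 hpos (norm_nonneg z) (by simpa using hz) z.arg
    have him : (herglotz u 0).im = 0 := by
      have := herglotz_circleMap hu le_rfl zero_lt_one 0
      rw [conjPoissonIntegral_radius_zero] at this
      simp only [circleMap_zero_radius, Function.const_apply] at this
      rw [this]; simp
    have := h (herglotz u) (differentiableOn_herglotz hu) hre him r hr0 hr1
    simpa [herglotz_circleMap hu hr0 hr1] using this

theorem lintegral_enorm_rpow_eq_eLpNorm_rpow {β : Type*} [MeasurableSpace β] {ν : Measure β}
    {p : ℝ} (hp : 0 < p) (f : β → ℝ) :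
    ∫⁻ x, ‖f x‖ₑ ^ p ∂ν = eLpNorm f (ENNReal.ofReal p) ν ^ p := by
  rw [eLpNorm_eq_lintegral_rpow_enorm_toReal (by simpa using hp) ENNReal.ofReal_ne_top,
    ENNReal.toReal_ofReal hp.le, ← ENNReal.rpow_mul, one_div_mul_cancel hp.ne', ENNReal.rpow_one]

theorem eLpNorm_le_mul_of_lintegral_le {β : Type*} [MeasurableSpace β] {ν : Measure β}
    {p : ℝ} (hp : 0 < p) {f g : β → ℝ} {c : ENNReal}
    (h : ∫⁻ x, ‖g x‖ₑ ^ p ∂ν ≤ c ^ p * ∫⁻ x, ‖f x‖ₑ ^ p ∂ν) :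
    eLpNorm g (ENNReal.ofReal p) ν ≤ c * eLpNorm f (ENNReal.ofReal p) ν := by
  rwa [lintegral_enorm_rpow_eq_eLpNorm_rpow hp, lintegral_enorm_rpow_eq_eLpNorm_rpow hp,
    ← ENNReal.mul_rpow_of_nonneg _ _ hp.le, ENNReal.rpow_le_rpow_iff hp] at h

theorem lintegral_rpow_le_mul_lintegral_rpow {β : Type*} [MeasurableSpace β] {ν : Measure β}
    {p : ℝ} (hp : 1 ≤ p) {g : β → ENNReal} (hg : AEMeasurable g ν) :
    (∫⁻ x, g x ∂ν) ^ p ≤ ν Set.univ ^ (p - 1) * ∫⁻ x, g x ^ p ∂ν := by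
  have hp0 : 0 < p := by linarith
  rcases hp.eq_or_lt with rfl | hp1
  · simp
  have hq := Real.HolderConjugate.conjExponent hp1
  have h := ENNReal.lintegral_mul_le_Lp_mul_Lq ν hq hg (aemeasurable_const (b := (1 : ENNReal)))
  simp only [Pi.mul_apply, mul_one, ENNReal.one_rpow, lintegral_const, one_mul] at h
  calc (∫⁻ x, g x ∂ν) ^ p
      ≤ ((∫⁻ x, g x ^ p ∂ν) ^ (1 / p) * ν Set.univ ^ (1 / p.conjExponent)) ^ p := by gcongr
    _ = _ := by
      rw [ENNReal.mul_rpow_of_nonneg _ _ hp0.le, ← ENNReal.rpow_mul, ← ENNReal.rpow_mul,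
        one_div_mul_cancel hp0.ne', ENNReal.rpow_one, mul_comm]
      congr 2
      rw [Real.conjExponent]
      field_simp

theorem lintegral_rpow_lintegral_kernel_le {ν₁ ν₂ : Measure ℝ} [SFinite ν₁] [SFinite ν₂]
    {p : ℝ} (hp : 1 ≤ p) {k : ℝ → ℝ → ENNReal} (hk : Measurable (Function.uncurry k))
    (hk1 : ∀ x, ∫⁻ t, k x t ∂ν₂ ≤ 1) (hk2 : ∀ t, ∫⁻ x, k x t ∂ν₁ ≤ 1)
    {g : ℝ → ENNReal} (hg : AEMeasurable g ν₂) :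
    ∫⁻ x, (∫⁻ t, k x t * g t ∂ν₂) ^ p ∂ν₁ ≤ ∫⁻ t, g t ^ p ∂ν₂ := by
  have hkx (x : ℝ) : Measurable (k x) := hk.comp measurable_prodMk_left
  have hkt (t : ℝ) : Measurable fun x ↦ k x t := hk.comp measurable_prodMk_right
  have h1 (x : ℝ) : (∫⁻ t, k x t * g t ∂ν₂) ^ p ≤ ∫⁻ t, k x t * g t ^ p ∂ν₂ := by
    have hac : AEMeasurable g (ν₂.withDensity (k x)) :=
      hg.mono_ac (withDensity_absolutelyContinuous _ _)
    have := lintegral_rpow_le_mul_lintegral_rpow hp hac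
    rw [lintegral_withDensity_eq_lintegral_mul₀ (hkx x).aemeasurable hg,
      lintegral_withDensity_eq_lintegral_mul₀ (hkx x).aemeasurable (hg.pow_const p)] at this
    refine this.trans (mul_le_of_le_one_left' ?_)
    rw [withDensity_apply _ MeasurableSet.univ, Measure.restrict_univ]
    exact ENNReal.rpow_le_one (hk1 x) (by linarith)
  calc ∫⁻ x, (∫⁻ t, k x t * g t ∂ν₂) ^ p ∂ν₁
      ≤ ∫⁻ x, ∫⁻ t, k x t * g t ^ p ∂ν₂ ∂ν₁ := lintegral_mono h1
    _ = ∫⁻ t, ∫⁻ x, k x t * g t ^ p ∂ν₁ ∂ν₂ := by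
        apply lintegral_lintegral_swap
        exact hk.aemeasurable.mul ((hg.comp_snd (μ := ν₁)).pow_const p)
    _ ≤ ∫⁻ t, g t ^ p ∂ν₂ := by
        apply lintegral_mono
        intro t
        dsimp only
        rw [lintegral_mul_const _ (hkt t)]
        exact mul_le_of_le_one_left' (hk2 t)

theorem poissonAngle_sub_comm (r x t : ℝ) : poissonAngle r (x - t) = poissonAngle r (t - x) := by
  unfold poissonAngle poissonDenom
  rw [← Real.cos_neg, neg_sub]

theorem integral_poissonAngle_sub {r : ℝ} (hr0 : 0 ≤ r) (hr1 : r < 1) (x : ℝ) :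
    ∫ t in (0 : ℝ)..(2 * π), poissonAngle r (x - t) = 2 * π := by
  have h := DiffContOnCl.circleAverage_poissonKernel_smul (f := fun _ : ℂ ↦ (1 : ℂ))
    (c := 0) (R := 1) (w := circleMap 0 r x) diffContOnCl_const
    (by simpa [abs_of_nonneg hr0] using hr1)
  have h2 (t : ℝ) : poissonKernel 0 (circleMap 0 r x) (circleMap 0 1 t) =
      poissonAngle r (x - t) := by
    rw [poissonKernel_eq_re_herglotzRieszKernel, Function.comp_apply,
      herglotzRieszKernel_circleMap hr0 hr1]
    simp
  rw [Real.circleAverage_def, inv_smul_eq_iff₀ Real.two_pi_pos.ne'] at h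
  simp only [Pi.smul_apply', h2] at h
  have h3 : ∫ t in (0 : ℝ)..(2 * π), poissonAngle r (x - t) • (1 : ℂ) =
      ((∫ t in (0 : ℝ)..(2 * π), poissonAngle r (x - t) : ℝ) : ℂ) := by
    rw [← intervalIntegral.integral_ofReal]
    simp
  rw [h3] at h
  have h4 : (((∫ t in (0 : ℝ)..(2 * π), poissonAngle r (x - t) : ℝ)) : ℂ) = ((2 * π : ℝ) : ℂ) := by
    rw [h]; simp
  exact_mod_cast h4

theorem lintegral_poissonAngle_sub {r : ℝ} (hr0 : 0 ≤ r) (hr1 : r < 1) (x : ℝ) :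
    ∫⁻ t, ENNReal.ofReal ((2 * π)⁻¹ * poissonAngle r (x - t)) ∂periodMeasure = 1 := by
  have hc : Continuous fun t ↦ (2 * π)⁻¹ * poissonAngle r (x - t) :=
    continuous_const.mul ((continuous_poissonAngle hr0 hr1).comp
      (continuous_const.sub continuous_id))
  rw [← ofReal_integral_eq_lintegral_ofReal]
  · rw [← intervalIntegral.integral_of_le Real.two_pi_pos.le,
      intervalIntegral.integral_const_mul, integral_poissonAngle_sub hr0 hr1,
      inv_mul_cancel₀ Real.two_pi_pos.ne', ENNReal.ofReal_one]
  · exact (hc.intervalIntegrable 0 (2 * π)).1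
  · exact Filter.Eventually.of_forall fun t ↦
      mul_nonneg (inv_pos.mpr Real.two_pi_pos).le (poissonAngle_pos hr0 hr1 _).le

theorem lintegral_poissonIntegral_rpow_le {p : ℝ} (hp : 1 ≤ p) {u : ℝ → ℝ}
    (hu : IntervalIntegrable u volume 0 (2 * π)) (hu0 : ∀ t, 0 ≤ u t)
    {r : ℝ} (hr0 : 0 ≤ r) (hr1 : r < 1) :
    ∫⁻ x, ENNReal.ofReal (poissonIntegral r u x) ^ p ∂periodMeasure ≤
      ∫⁻ x, ENNReal.ofReal (u x) ^ p ∂periodMeasure := by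
  have hpi := Real.two_pi_pos
  have h (x : ℝ) : ENNReal.ofReal (poissonIntegral r u x) =
      ∫⁻ t, ENNReal.ofReal ((2 * π)⁻¹ * poissonAngle r (x - t)) * ENNReal.ofReal (u t)
        ∂periodMeasure := by
    rw [poissonIntegral, ← intervalIntegral.integral_const_mul,
      intervalIntegral.integral_of_le Real.two_pi_pos.le, ofReal_integral_eq_lintegral_ofReal]
    · refine lintegral_congr fun t ↦ ?_
      rw [← ENNReal.ofReal_mul (mul_nonneg (inv_pos.mpr hpi).le (poissonAngle_pos hr0 hr1 _).le)]
      congr 1; ring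
    · exact ((hu.mul_continuousOn ((continuous_poissonAngle hr0 hr1).comp
        (continuous_const.sub continuous_id)).continuousOn).const_mul _).1
    · exact Filter.Eventually.of_forall fun t ↦ mul_nonneg (inv_pos.mpr hpi).le
        (mul_nonneg (hu0 t) (poissonAngle_pos hr0 hr1 _).le)
  simp_rw [h]
  apply lintegral_rpow_lintegral_kernel_le hp
    (k := fun x t ↦ ENNReal.ofReal ((2 * π)⁻¹ * poissonAngle r (x - t)))
  · apply Measurable.ennreal_ofReal
    apply Continuous.measurable
    exact continuous_const.mul ((continuous_poissonAngle hr0 hr1).comp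
      (continuous_fst.sub continuous_snd))
  · exact fun x ↦ (lintegral_poissonAngle_sub hr0 hr1 x).le
  · intro t
    simp_rw [poissonAngle_sub_comm r _ t]
    exact (lintegral_poissonAngle_sub hr0 hr1 t).le
  · exact hu.1.aestronglyMeasurable.aemeasurable.ennreal_ofReal

theorem continuous_intervalIntegral_mul_sub {u k : ℝ → ℝ}
    (hu : IntervalIntegrable u volume 0 (2 * π)) (hk : Continuous k) {M : ℝ}
    (hM : ∀ θ, |k θ| ≤ M) :
    Continuous fun x ↦ ∫ t in (0 : ℝ)..(2 * π), u t * k (x - t) := by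
  apply intervalIntegral.continuous_of_dominated_interval (bound := fun t ↦ |u t| * M)
  · intro x
    rw [Set.uIoc_of_le Real.two_pi_pos.le]
    exact (hu.mul_continuousOn
      (hk.comp (continuous_const.sub continuous_id)).continuousOn).1.aestronglyMeasurable
  · intro x
    refine Filter.Eventually.of_forall fun t _ ↦ ?_
    rw [Real.norm_eq_abs, abs_mul]
    exact mul_le_mul_of_nonneg_left (hM _) (abs_nonneg _)
  · exact hu.abs.mul_const M
  · refine Filter.Eventually.of_forall fun t _ ↦ ?_
    exact continuous_const.mul (hk.comp (continuous_id.sub continuous_const))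

theorem poissonDenom_ge {r : ℝ} (hr0 : 0 ≤ r) (θ : ℝ) : (1 - r) ^ 2 ≤ poissonDenom r θ := by
  unfold poissonDenom; nlinarith [Real.cos_le_one θ]

theorem abs_conjPoisson_le {r : ℝ} (hr0 : 0 ≤ r) (hr1 : r < 1) (θ : ℝ) :
    |conjPoisson r θ| ≤ 2 * r / (1 - r) ^ 2 := by
  have h1 : 0 < (1 - r) ^ 2 := by have := sub_pos.mpr hr1; positivity
  unfold conjPoisson
  rw [abs_div, abs_of_pos (poissonDenom_pos hr0 hr1 θ)]
  apply div_le_div₀ (by positivity) _ h1 (poissonDenom_ge hr0 θ)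
  rw [abs_mul, abs_of_nonneg (by positivity : 0 ≤ 2 * r)]
  exact mul_le_of_le_one_right (by positivity) (Real.abs_sin_le_one θ)

theorem abs_poissonAngle_le {r : ℝ} (hr0 : 0 ≤ r) (hr1 : r < 1) (θ : ℝ) :
    |poissonAngle r θ| ≤ (1 - r ^ 2) / (1 - r) ^ 2 := by
  have h1 : 0 < (1 - r) ^ 2 := by have := sub_pos.mpr hr1; positivity
  rw [abs_of_pos (poissonAngle_pos hr0 hr1 θ)]
  exact div_le_div_of_nonneg_left (by nlinarith) h1 (poissonDenom_ge hr0 θ)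

theorem continuous_conjPoissonIntegral {u : ℝ → ℝ}
    (hu : IntervalIntegrable u volume 0 (2 * π)) {r : ℝ} (hr0 : 0 ≤ r) (hr1 : r < 1) :
    Continuous (conjPoissonIntegral r u) :=
  continuous_const.mul (continuous_intervalIntegral_mul_sub hu (continuous_conjPoisson hr0 hr1)
    (abs_conjPoisson_le hr0 hr1))

theorem continuous_poissonIntegral {u : ℝ → ℝ}
    (hu : IntervalIntegrable u volume 0 (2 * π)) {r : ℝ} (hr0 : 0 ≤ r) (hr1 : r < 1) :
    Continuous (poissonIntegral r u) :=
  continuous_const.mul (continuous_intervalIntegral_mul_sub hu (continuous_poissonAngle hr0 hr1)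
    (abs_poissonAngle_le hr0 hr1))

theorem lintegral_enorm_rpow_eq_ofReal {p : ℝ} (hp : 0 < p) {g : ℝ → ℝ} (hg : Continuous g) :
    ∫⁻ x, ‖g x‖ₑ ^ p ∂periodMeasure =
      ENNReal.ofReal (∫ x in (0 : ℝ)..(2 * π), |g x| ^ p) := by
  rw [intervalIntegral.integral_of_le Real.two_pi_pos.le, ofReal_integral_eq_lintegral_ofReal]
  · refine lintegral_congr fun x ↦ ?_
    rw [← ENNReal.ofReal_rpow_of_nonneg (abs_nonneg _) hp.le, ← Real.enorm_eq_ofReal_abs]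
  · exact ((hg.abs.rpow_const fun _ ↦ Or.inr hp.le).intervalIntegrable 0 (2 * π)).1
  · exact Filter.Eventually.of_forall fun x ↦ by positivity

theorem MeasureTheory.MemLp.intervalIntegrable_period {p : ℝ} (hp : 1 ≤ p) {u : ℝ → ℝ}
    (hu : MemLp u (ENNReal.ofReal p) periodMeasure) : IntervalIntegrable u volume 0 (2 * π) := by
  rw [intervalIntegrable_iff_integrableOn_Ioc_of_le Real.two_pi_pos.le]
  exact hu.integrable (by simpa using hp)

theorem exists_eLpNorm_conjPoissonIntegral_le_of_nonneg {p : ℝ} (hp : 1 < p) (hp2 : p ≤ 2) :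
    ∃ C : NNReal, ∀ u : ℝ → ℝ, MemLp u (ENNReal.ofReal p) periodMeasure → (∀ t, 0 ≤ u t) →
      ∀ r : ℝ, 0 ≤ r → r < 1 →
        eLpNorm (conjPoissonIntegral r u) (ENNReal.ofReal p) periodMeasure ≤
          C * eLpNorm u (ENNReal.ofReal p) periodMeasure := by
  obtain ⟨A, hA, h⟩ := exists_integral_conjPoissonIntegral_le hp hp2
  have hp0 : 0 < p := by linarith
  refine ⟨A.toNNReal ^ (1 / p), fun u hu hu0 r hr0 hr1 ↦ ?_⟩
  have hui := hu.intervalIntegrable_period hp.le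
  apply eLpNorm_le_mul_of_lintegral_le hp0
  have hP0 (x : ℝ) : 0 ≤ poissonIntegral r u x :=
    mul_nonneg (inv_pos.mpr Real.two_pi_pos).le (intervalIntegral.integral_nonneg
      Real.two_pi_pos.le fun t _ ↦ mul_nonneg (hu0 t) (poissonAngle_pos hr0 hr1 _).le)
  have hc : ((A.toNNReal ^ (1 / p) : NNReal) : ENNReal) ^ p = ENNReal.ofReal A := by
    rw [← ENNReal.coe_rpow_of_nonneg _ hp0.le, ← NNReal.rpow_mul, one_div_mul_cancel hp0.ne',
      NNReal.rpow_one]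
    rfl
  rw [hc, lintegral_enorm_rpow_eq_ofReal hp0 (continuous_conjPoissonIntegral hui hr0 hr1)]
  calc ENNReal.ofReal (∫ x in (0 : ℝ)..(2 * π), |conjPoissonIntegral r u x| ^ p)
      ≤ ENNReal.ofReal (A * ∫ x in (0 : ℝ)..(2 * π), |poissonIntegral r u x| ^ p) := by
        apply ENNReal.ofReal_le_ofReal
        simp_rw [abs_of_nonneg (hP0 _)]
        exact h u hui hu0 r hr0 hr1
    _ = ENNReal.ofReal A * ∫⁻ x, ENNReal.ofReal (poissonIntegral r u x) ^ p ∂periodMeasure := by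
        rw [ENNReal.ofReal_mul hA, ← lintegral_enorm_rpow_eq_ofReal hp0
          (continuous_poissonIntegral hui hr0 hr1)]
        simp_rw [Real.enorm_of_nonneg (hP0 _)]
    _ ≤ ENNReal.ofReal A * ∫⁻ x, ENNReal.ofReal (u x) ^ p ∂periodMeasure := by
        exact mul_le_mul' le_rfl (lintegral_poissonIntegral_rpow_le hp.le hui hu0 hr0 hr1)
    _ = _ := by simp_rw [Real.enorm_of_nonneg (hu0 _)]

/-- **M. Riesz's theorem** for the conjugate Poisson integrals, exponents at most two. -/
theorem exists_eLpNorm_conjPoissonIntegral_le {p : ℝ} (hp : 1 < p) (hp2 : p ≤ 2) :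
    ∃ C : NNReal, ∀ u : ℝ → ℝ, MemLp u (ENNReal.ofReal p) periodMeasure →
      ∀ r : ℝ, 0 ≤ r → r < 1 →
        eLpNorm (conjPoissonIntegral r u) (ENNReal.ofReal p) periodMeasure ≤
          C * eLpNorm u (ENNReal.ofReal p) periodMeasure := by
  obtain ⟨C, h⟩ := exists_eLpNorm_conjPoissonIntegral_le_of_nonneg hp hp2
  refine ⟨2 * C, fun u hu r hr0 hr1 ↦ ?_⟩
  have hup : MemLp (fun t ↦ max (u t) 0) (ENNReal.ofReal p) periodMeasure := hu.pos_part
  have hun : MemLp (fun t ↦ max (-u t) 0) (ENNReal.ofReal p) periodMeasure := hu.neg_part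
  have hkc (x : ℝ) : ContinuousOn (fun t ↦ conjPoisson r (x - t)) (Set.uIcc 0 (2 * π)) :=
    ((continuous_conjPoisson hr0 hr1).comp (continuous_const.sub continuous_id)).continuousOn
  have hsplit : conjPoissonIntegral r u =
      conjPoissonIntegral r (fun t ↦ max (u t) 0) -
        conjPoissonIntegral r (fun t ↦ max (-u t) 0) := by
    ext x
    simp only [conjPoissonIntegral, Pi.sub_apply]
    rw [← mul_sub, ← intervalIntegral.integral_sub
      ((hup.intervalIntegrable_period hp.le).mul_continuousOn (hkc x))
      ((hun.intervalIntegrable_period hp.le).mul_continuousOn (hkc x))]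
    congr 2
    ext t
    rw [← sub_mul]
    congr 1
    rcases le_total 0 (u t) with h | h
    · simp [h]
    · simp [h]
  rw [hsplit]
  calc _ ≤ eLpNorm (conjPoissonIntegral r (fun t ↦ max (u t) 0)) (ENNReal.ofReal p) periodMeasure +
        eLpNorm (conjPoissonIntegral r (fun t ↦ max (-u t) 0)) (ENNReal.ofReal p) periodMeasure :=
        eLpNorm_sub_le
          (continuous_conjPoissonIntegral (hup.intervalIntegrable_period hp.le) hr0
            hr1).aestronglyMeasurable
          (continuous_conjPoissonIntegral (hun.intervalIntegrable_period hp.le) hr0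
            hr1).aestronglyMeasurable
          (by simpa using hp.le)
    _ ≤ C * eLpNorm u (ENNReal.ofReal p) periodMeasure +
        C * eLpNorm u (ENNReal.ofReal p) periodMeasure := by
        gcongr
        · refine (h _ hup (fun t ↦ le_max_right _ _) r hr0 hr1).trans ?_
          gcongr
          refine eLpNorm_mono fun t ↦ ?_
          rcases le_total 0 (u t) with h | h <;> simp [h]
        · refine (h _ hun (fun t ↦ le_max_right _ _) r hr0 hr1).trans ?_
          gcongr
          refine eLpNorm_mono fun t ↦ ?_
          rcases le_total 0 (u t) with h | h <;> simp [h]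
    _ = _ := by push_cast; ring

theorem two_mul_dirichletKernel_mul_one_sub_cos (n : ℕ) (θ : ℝ) :
    2 * dirichletKernel n θ * (1 - Real.cos θ) = Real.cos (n * θ) - Real.cos ((n + 1) * θ) := by
  induction n with
  | zero => simp [dirichletKernel]
  | succ n ih =>
    have h1 : dirichletKernel (n + 1) θ = dirichletKernel n θ + Real.cos ((n + 1) * θ) := by
      unfold dirichletKernel
      rw [Finset.sum_Icc_succ_top (by omega)]
      push_cast; ring
    have h2 := Real.cos_add ((n + 1) * θ) θ
    have h3 := Real.cos_sub ((n + 1) * θ) θ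
    have e2 : ((n + 1 : ℝ)) * θ + θ = (n + 1 + 1) * θ := by ring
    have e3 : ((n + 1 : ℝ)) * θ - θ = n * θ := by ring
    rw [e2] at h2
    rw [e3] at h3
    rw [h1]
    push_cast
    linear_combination ih + h2 + h3

theorem two_mul_dirichletKernel_eq (n : ℕ) {θ : ℝ} (hθ : Real.cos θ ≠ 1) :
    2 * dirichletKernel n θ = Real.sin (n * θ) * conjPoisson 1 θ + Real.cos (n * θ) := by
  have h : 1 - Real.cos θ ≠ 0 := sub_ne_zero.mpr hθ.symm
  have hd : poissonDenom 1 θ = 2 * (1 - Real.cos θ) := by unfold poissonDenom; ring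
  have h1 := two_mul_dirichletKernel_mul_one_sub_cos n θ
  have h2 := Real.cos_add (n * θ) θ
  rw [show (n : ℝ) * θ + θ = (n + 1) * θ by ring] at h2
  apply mul_right_cancel₀ h
  rw [h1, conjPoisson, hd, h2]
  field_simp
  ring

theorem abs_sin_natCast_mul_le (n : ℕ) (θ : ℝ) : |Real.sin (n * θ)| ≤ n * |Real.sin θ| := by
  induction n with
  | zero => simp
  | succ n ih =>
    push_cast
    rw [add_mul, one_mul, Real.sin_add]
    calc _ ≤ |Real.sin (n * θ) * Real.cos θ| + |Real.cos (n * θ) * Real.sin θ| := abs_add_le _ _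
      _ ≤ |Real.sin (n * θ)| + |Real.sin θ| := by
        rw [abs_mul, abs_mul]
        exact add_le_add (mul_le_of_le_one_right (abs_nonneg _) (Real.abs_cos_le_one _))
          (mul_le_of_le_one_left (abs_nonneg _) (Real.abs_cos_le_one _))
      _ ≤ _ := by linarith

theorem abs_sin_mul_conjPoisson_le (n : ℕ) {r : ℝ} (hr0 : 0 ≤ r) (hr1 : r < 1) (θ : ℝ) :
    |Real.sin (n * θ) * conjPoisson r θ| ≤ 2 * n := by
  have hd := poissonDenom_pos hr0 hr1 θ
  have hs : Real.sin θ ^ 2 ≤ poissonDenom r θ := by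
    unfold poissonDenom
    nlinarith [Real.sin_sq_add_cos_sq θ, sq_nonneg (r - Real.cos θ)]
  rw [conjPoisson, ← mul_div_assoc, abs_div, abs_of_pos hd, div_le_iff₀ hd, abs_mul, abs_mul,
    abs_of_nonneg (by positivity : 0 ≤ 2 * r)]
  calc |Real.sin (n * θ)| * (2 * r * |Real.sin θ|)
      ≤ (n * |Real.sin θ|) * (2 * 1 * |Real.sin θ|) := by
        gcongr
        exact abs_sin_natCast_mul_le n θ
    _ = 2 * n * Real.sin θ ^ 2 := by rw [← sq_abs (Real.sin θ)]; ring
    _ ≤ _ := by gcongr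

/-- Abel-type regularization of the partial Fourier sums. -/
noncomputable def regularizedSum (r : ℝ) (f : ℝ → ℝ) (n : ℕ) (x : ℝ) : ℝ :=
  (2 * π)⁻¹ * ∫ t in (0 : ℝ)..(2 * π),
    f t * (Real.sin (n * (x - t)) * conjPoisson r (x - t) + Real.cos (n * (x - t)))

theorem continuous_dirichletKernel (n : ℕ) : Continuous (dirichletKernel n) := by
  unfold dirichletKernel; fun_prop

theorem abs_dirichletKernel_le (n : ℕ) (u : ℝ) : |dirichletKernel n u| ≤ n + 1 / 2 := by
  unfold dirichletKernel
  rw [add_comm]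
  refine (abs_add_le _ _).trans (add_le_add ?_ (by norm_num))
  refine (Finset.abs_sum_le_sum_abs _ _).trans ?_
  refine (Finset.sum_le_sum fun k _ ↦ Real.abs_cos_le_one _).trans ?_
  simp

theorem continuous_partialFourierSum {f : ℝ → ℝ} (hf : IntervalIntegrable f volume 0 (2 * π))
    (n : ℕ) : Continuous (partialFourierSum f n) := by
  refine continuous_const.mul (continuous_intervalIntegral_mul_sub hf
    (continuous_dirichletKernel n) (M := n + 1 / 2) fun θ ↦ abs_dirichletKernel_le n θ)

theorem ae_cos_sub_ne_one (x : ℝ) : ∀ᵐ t : ℝ, Real.cos (x - t) ≠ 1 := by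
  have hc : (Set.range fun m : ℤ ↦ x - m * (2 * π)).Countable := Set.countable_range _
  filter_upwards [hc.ae_notMem volume] with t ht h
  obtain ⟨m, hm⟩ := (Real.cos_eq_one_iff _).mp h
  exact ht ⟨m, by simp [hm]⟩

theorem tendsto_regularizedSum {f : ℝ → ℝ} (hf : IntervalIntegrable f volume 0 (2 * π)) (n : ℕ)
    (x : ℝ) : Filter.Tendsto (fun m : ℕ ↦ regularizedSum (1 - 1 / ((m : ℝ) + 1)) f n x)
      Filter.atTop (nhds (partialFourierSum f n x)) := by
  have hr (m : ℕ) : 0 ≤ 1 - 1 / ((m : ℝ) + 1) ∧ 1 - 1 / ((m : ℝ) + 1) < 1 := by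
    have h1 : 1 / ((m : ℝ) + 1) ≤ 1 := by
      rw [div_le_one (by positivity)]; linarith [(Nat.cast_nonneg m : (0 : ℝ) ≤ m)]
    have h2 : 0 < 1 / ((m : ℝ) + 1) := by positivity
    constructor <;> linarith
  have hlim : Filter.Tendsto (fun m : ℕ ↦ 1 - 1 / ((m : ℝ) + 1)) Filter.atTop (nhds 1) := by
    simpa using tendsto_const_nhds.sub (tendsto_one_div_add_atTop_nhds_zero_nat (𝕜 := ℝ))
  have hS : partialFourierSum f n x =
      (2 * π)⁻¹ * ∫ t in (0 : ℝ)..(2 * π), f t * (2 * dirichletKernel n (x - t)) := by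
    have : ∀ t, f t * (2 * dirichletKernel n (x - t)) = 2 * (f t * dirichletKernel n (x - t)) :=
      fun t ↦ by ring
    simp_rw [this]
    rw [intervalIntegral.integral_const_mul, partialFourierSum]
    have := Real.pi_pos
    field_simp
  rw [hS]
  apply Filter.Tendsto.const_mul
  apply intervalIntegral.tendsto_integral_filter_of_dominated_convergence
    (fun t ↦ |f t| * (2 * n + 1))
  · refine Filter.Eventually.of_forall fun m ↦ ?_
    rw [Set.uIoc_of_le Real.two_pi_pos.le]
    have hc : Continuous fun t ↦ Real.sin (n * (x - t)) *
        conjPoisson (1 - 1 / ((m : ℝ) + 1)) (x - t) + Real.cos (n * (x - t)) := by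
      have := (continuous_conjPoisson (hr m).1 (hr m).2).comp
        ((continuous_const (y := x)).sub continuous_id)
      exact (Continuous.mul (by fun_prop) this).add (by fun_prop)
    exact (hf.mul_continuousOn hc.continuousOn).1.aestronglyMeasurable
  · refine Filter.Eventually.of_forall fun m ↦ Filter.Eventually.of_forall fun t _ ↦ ?_
    rw [Real.norm_eq_abs, abs_mul]
    refine mul_le_mul_of_nonneg_left ((abs_add_le _ _).trans ?_) (abs_nonneg _)
    exact add_le_add (abs_sin_mul_conjPoisson_le n (hr m).1 (hr m).2 _) (Real.abs_cos_le_one _)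
  · exact hf.abs.mul_const _
  · filter_upwards [ae_cos_sub_ne_one x] with t ht _
    rw [two_mul_dirichletKernel_eq n ht]
    apply Filter.Tendsto.const_mul
    apply Filter.Tendsto.add_const
    apply Filter.Tendsto.const_mul
    have hc : ContinuousAt (fun r ↦ conjPoisson r (x - t)) 1 := by
      unfold conjPoisson poissonDenom
      apply ContinuousAt.div (by fun_prop) (by fun_prop)
      intro h
      apply ht
      linarith
    exact hc.tendsto.comp hlim

theorem regularizedSum_eq {f : ℝ → ℝ} (hf : IntervalIntegrable f volume 0 (2 * π)) (n : ℕ)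
    {r : ℝ} (hr0 : 0 ≤ r) (hr1 : r < 1) (x : ℝ) :
    regularizedSum r f n x =
      Real.sin (n * x) * conjPoissonIntegral r (fun t ↦ f t * Real.cos (n * t)) x -
      Real.cos (n * x) * conjPoissonIntegral r (fun t ↦ f t * Real.sin (n * t)) x +
      (2 * π)⁻¹ * ∫ t in (0 : ℝ)..(2 * π), f t * Real.cos (n * (x - t)) := by
  have hk : Continuous fun t ↦ conjPoisson r (x - t) :=
    (continuous_conjPoisson hr0 hr1).comp (continuous_const.sub continuous_id)
  have i1 : IntervalIntegrable (fun t ↦ f t * Real.cos (n * t) * conjPoisson r (x - t))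
      volume 0 (2 * π) := by
    simp_rw [mul_assoc]
    exact hf.mul_continuousOn (Continuous.mul (by fun_prop) hk).continuousOn
  have i2 : IntervalIntegrable (fun t ↦ f t * Real.sin (n * t) * conjPoisson r (x - t))
      volume 0 (2 * π) := by
    simp_rw [mul_assoc]
    exact hf.mul_continuousOn (Continuous.mul (by fun_prop) hk).continuousOn
  have i3 : IntervalIntegrable (fun t ↦ f t * Real.cos (n * (x - t))) volume 0 (2 * π) :=
    hf.mul_continuousOn (by fun_prop)
  have he : ∀ t, f t * (Real.sin (n * (x - t)) * conjPoisson r (x - t) + Real.cos (n * (x - t))) =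
      (Real.sin (n * x) * (f t * Real.cos (n * t) * conjPoisson r (x - t)) -
      Real.cos (n * x) * (f t * Real.sin (n * t) * conjPoisson r (x - t))) +
      f t * Real.cos (n * (x - t)) := by
    intro t
    have hs := Real.sin_sub (n * x) (n * t)
    rw [← mul_sub] at hs
    rw [hs]; ring
  unfold regularizedSum conjPoissonIntegral
  simp_rw [he]
  rw [intervalIntegral.integral_add ((i1.const_mul _).sub (i2.const_mul _)) i3,
    intervalIntegral.integral_sub (i1.const_mul _) (i2.const_mul _),
    intervalIntegral.integral_const_mul, intervalIntegral.integral_const_mul]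
  ring

theorem eLpNorm_mul_le_of_abs_le_one {β : Type*} [MeasurableSpace β] {ν : Measure β}
    {p : ENNReal} {f c : β → ℝ} (hc : ∀ t, |c t| ≤ 1) :
    eLpNorm (fun t ↦ c t * f t) p ν ≤ eLpNorm f p ν := by
  refine eLpNorm_mono fun t ↦ ?_
  rw [norm_mul]
  exact mul_le_of_le_one_left (norm_nonneg _) (hc t)

theorem eLpNorm_integral_mul_cos_le {p : ℝ} (hp : 1 < p) {f : ℝ → ℝ}
    (hf : MemLp f (ENNReal.ofReal p) periodMeasure) (n : ℕ) :
    eLpNorm (fun x ↦ (2 * π)⁻¹ * ∫ t in (0 : ℝ)..(2 * π), f t * Real.cos (n * (x - t)))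
      (ENNReal.ofReal p) periodMeasure ≤ eLpNorm f (ENNReal.ofReal p) periodMeasure := by
  have hp0 : 0 < p := by linarith
  have h2 : (0 : ℝ) ≤ (2 * π)⁻¹ := (inv_pos.mpr Real.two_pi_pos).le
  have hone : ∫⁻ _ : ℝ, ENNReal.ofReal ((2 * π)⁻¹) ∂periodMeasure = 1 := by
    rw [lintegral_const, Measure.restrict_apply MeasurableSet.univ, Set.univ_inter,
      Real.volume_Ioc, sub_zero, ← ENNReal.ofReal_mul h2, inv_mul_cancel₀ Real.two_pi_pos.ne',
      ENNReal.ofReal_one]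
  rw [← one_mul (eLpNorm f _ _)]
  apply eLpNorm_le_mul_of_lintegral_le hp0
  rw [ENNReal.one_rpow, one_mul]
  refine le_trans (lintegral_mono fun x ↦ ?_) (lintegral_rpow_lintegral_kernel_le hp.le
    (ν₁ := periodMeasure) (k := fun _ _ ↦ ENNReal.ofReal ((2 * π)⁻¹)) measurable_const
    (fun _ ↦ hone.le) (fun _ ↦ hone.le) hf.1.enorm)
  gcongr
  rw [enorm_mul, Real.enorm_of_nonneg h2, lintegral_const_mul'' _ hf.1.enorm]
  gcongr
  rw [intervalIntegral.integral_of_le Real.two_pi_pos.le]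
  refine (enorm_integral_le_lintegral_enorm _).trans (lintegral_mono fun t ↦ ?_)
  rw [enorm_mul]
  refine mul_le_of_le_one_right' ?_
  rw [Real.enorm_eq_ofReal_abs]
  exact ENNReal.ofReal_le_one.mpr (Real.abs_cos_le_one _)

/-- Uniform `L^p` boundedness of partial Fourier sums, exponents at most two. -/
theorem exists_eLpNorm_partialFourierSum_le_of_le_two {p : ℝ} (hp : 1 < p) (hp2 : p ≤ 2) :
    ∃ C : NNReal, ∀ (f : ℝ → ℝ) (n : ℕ), MemLp f (ENNReal.ofReal p) periodMeasure →
      eLpNorm (partialFourierSum f n) (ENNReal.ofReal p) periodMeasure ≤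
        C * eLpNorm f (ENNReal.ofReal p) periodMeasure := by
  obtain ⟨C, h⟩ := exists_eLpNorm_conjPoissonIntegral_le hp hp2
  refine ⟨C + C + 1, fun f n hf ↦ ?_⟩
  have hfi := hf.intervalIntegrable_period hp.le
  have hP1 : 1 ≤ ENNReal.ofReal p := by simpa using hp.le
  have hcos : MemLp (fun t ↦ f t * Real.cos (n * t)) (ENNReal.ofReal p) periodMeasure := by
    refine hf.mono (hf.1.mul (by fun_prop : Continuous _).aestronglyMeasurable)
      (Filter.Eventually.of_forall fun t ↦ ?_)
    rw [norm_mul]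
    exact mul_le_of_le_one_right (norm_nonneg _) (Real.abs_cos_le_one _)
  have hsin : MemLp (fun t ↦ f t * Real.sin (n * t)) (ENNReal.ofReal p) periodMeasure := by
    refine hf.mono (hf.1.mul (by fun_prop : Continuous _).aestronglyMeasurable)
      (Filter.Eventually.of_forall fun t ↦ ?_)
    rw [norm_mul]
    exact mul_le_of_le_one_right (norm_nonneg _) (Real.abs_sin_le_one _)
  have hcos_le : eLpNorm (fun t ↦ f t * Real.cos (n * t)) (ENNReal.ofReal p) periodMeasure ≤
      eLpNorm f (ENNReal.ofReal p) periodMeasure := by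
    simp_rw [mul_comm (f _)]
    exact eLpNorm_mul_le_of_abs_le_one fun t ↦ Real.abs_cos_le_one _
  have hsin_le : eLpNorm (fun t ↦ f t * Real.sin (n * t)) (ENNReal.ofReal p) periodMeasure ≤
      eLpNorm f (ENNReal.ofReal p) periodMeasure := by
    simp_rw [mul_comm (f _)]
    exact eLpNorm_mul_le_of_abs_le_one fun t ↦ Real.abs_sin_le_one _
  have hc3 : Continuous fun x ↦ (2 * π)⁻¹ * ∫ t in (0 : ℝ)..(2 * π),
      f t * Real.cos (n * (x - t)) :=
    continuous_const.mul (continuous_intervalIntegral_mul_sub hfi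
      (k := fun θ ↦ Real.cos (n * θ)) (by fun_prop) (M := 1) fun θ ↦ Real.abs_cos_le_one _)
  have hreg (r : ℝ) (hr0 : 0 ≤ r) (hr1 : r < 1) :
      Continuous (regularizedSum r f n) ∧
      eLpNorm (regularizedSum r f n) (ENNReal.ofReal p) periodMeasure ≤
        ((C + C + 1 : NNReal) : ENNReal) * eLpNorm f (ENNReal.ofReal p) periodMeasure := by
    have hc1 : Continuous fun x ↦ Real.sin (n * x) *
        conjPoissonIntegral r (fun t ↦ f t * Real.cos (n * t)) x :=
      Continuous.mul (by fun_prop)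
        (continuous_conjPoissonIntegral (hcos.intervalIntegrable_period hp.le) hr0 hr1)
    have hc2 : Continuous fun x ↦ Real.cos (n * x) *
        conjPoissonIntegral r (fun t ↦ f t * Real.sin (n * t)) x :=
      Continuous.mul (by fun_prop)
        (continuous_conjPoissonIntegral (hsin.intervalIntegrable_period hp.le) hr0 hr1)
    have he : regularizedSum r f n = ((fun x ↦ Real.sin (n * x) *
        conjPoissonIntegral r (fun t ↦ f t * Real.cos (n * t)) x) - fun x ↦ Real.cos (n * x) *
        conjPoissonIntegral r (fun t ↦ f t * Real.sin (n * t)) x) + fun x ↦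
        (2 * π)⁻¹ * ∫ t in (0 : ℝ)..(2 * π), f t * Real.cos (n * (x - t)) :=
      funext fun x ↦ regularizedSum_eq hfi n hr0 hr1 x
    rw [he]
    refine ⟨(hc1.sub hc2).add hc3, ?_⟩
    refine (eLpNorm_add_le (hc1.sub hc2).aestronglyMeasurable hc3.aestronglyMeasurable hP1).trans ?_
    push_cast
    rw [add_mul, add_mul, one_mul]
    refine add_le_add ((eLpNorm_sub_le hc1.aestronglyMeasurable hc2.aestronglyMeasurable
      hP1).trans (add_le_add ?_ ?_)) (eLpNorm_integral_mul_cos_le hp hf n)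
    · exact (eLpNorm_mul_le_of_abs_le_one fun t ↦ Real.abs_sin_le_one _).trans
        ((h _ hcos r hr0 hr1).trans (mul_le_mul' le_rfl hcos_le))
    · exact (eLpNorm_mul_le_of_abs_le_one fun t ↦ Real.abs_cos_le_one _).trans
        ((h _ hsin r hr0 hr1).trans (mul_le_mul' le_rfl hsin_le))
  have hr (m : ℕ) : 0 ≤ 1 - 1 / ((m : ℝ) + 1) ∧ 1 - 1 / ((m : ℝ) + 1) < 1 := by
    have h1 : 1 / ((m : ℝ) + 1) ≤ 1 := by
      rw [div_le_one (by positivity)]; linarith [(Nat.cast_nonneg m : (0 : ℝ) ≤ m)]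
    have h2 : 0 < 1 / ((m : ℝ) + 1) := by positivity
    constructor <;> linarith
  refine (Lp.eLpNorm_lim_le_liminf_eLpNorm
    (f := fun m : ℕ ↦ regularizedSum (1 - 1 / ((m : ℝ) + 1)) f n)
    (fun m ↦ (hreg _ (hr m).1 (hr m).2).1.aestronglyMeasurable) _
    (Filter.Eventually.of_forall fun x ↦ tendsto_regularizedSum hfi n x)).trans ?_
  exact Filter.liminf_le_of_frequently_le'
    (Filter.Frequently.of_forall fun m ↦ (hreg _ (hr m).1 (hr m).2).2)

theorem integral_cos_sub_intCast_mul {m : ℤ} (hm : m ≠ 0) (c : ℝ) :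
    ∫ s in (0 : ℝ)..(2 * π), Real.cos (c - m * s) = 0 := by
  rw [intervalIntegral.integral_comp_sub_mul Real.cos (Int.cast_ne_zero.mpr hm), integral_cos,
    Real.sin_sub_int_mul_two_pi]
  simp

theorem integral_cos_mul_cos {i j : ℕ} (hj : 1 ≤ j) (x t : ℝ) :
    ∫ s in (0 : ℝ)..(2 * π), Real.cos (j * (x - s)) * Real.cos (i * (t - s)) =
      if i = j then π * Real.cos (j * (x - t)) else 0 := by
  have h1 : ∀ s, Real.cos (j * (x - s)) * Real.cos (i * (t - s)) =
      1 / 2 * Real.cos ((j * x - i * t) - ((j - i : ℤ) : ℝ) * s) +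
      1 / 2 * Real.cos ((j * x + i * t) - ((j + i : ℤ) : ℝ) * s) := by
    intro s
    have h2 := Real.cos_add (j * (x - s)) (i * (t - s))
    have h3 := Real.cos_sub (j * (x - s)) (i * (t - s))
    push_cast
    rw [show (j : ℝ) * x - i * t - (j - i) * s = j * (x - s) - i * (t - s) by ring,
      show (j : ℝ) * x + i * t - (j + i) * s = j * (x - s) + i * (t - s) by ring, h2, h3]
    ring
  simp_rw [h1]
  rw [intervalIntegral.integral_add (Continuous.intervalIntegrable (by fun_prop) _ _)
    (Continuous.intervalIntegrable (by fun_prop) _ _), intervalIntegral.integral_const_mul,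
    intervalIntegral.integral_const_mul, integral_cos_sub_intCast_mul (m := j + i) (by omega)]
  split_ifs with h
  · subst h
    simp [← mul_sub]
    ring
  · rw [integral_cos_sub_intCast_mul (by omega)]
    simp

theorem integral_cos_mul_dirichletKernel {j n : ℕ} (hj : 1 ≤ j) (hjn : j ≤ n) (x t : ℝ) :
    ∫ s in (0 : ℝ)..(2 * π), Real.cos (j * (x - s)) * dirichletKernel n (t - s) =
      π * Real.cos (j * (x - t)) := by
  have h0 := integral_cos_mul_cos (i := 0) hj x t
  rw [if_neg (by omega)] at h0
  simp only [Nat.cast_zero, zero_mul, Real.cos_zero, mul_one] at h0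
  simp_rw [dirichletKernel, mul_add, Finset.mul_sum]
  rw [intervalIntegral.integral_add (Continuous.intervalIntegrable (by fun_prop) _ _)
    (Continuous.intervalIntegrable (by fun_prop) _ _), intervalIntegral.integral_mul_const, h0,
    intervalIntegral.integral_finsetSum
      fun i _ ↦ Continuous.intervalIntegrable (by fun_prop) _ _]
  simp_rw [integral_cos_mul_cos hj]
  rw [Finset.sum_ite_eq' (Finset.Icc 1 n) j, if_pos (Finset.mem_Icc.mpr ⟨hj, hjn⟩)]
  simp

theorem integral_dirichletKernel_sub (n : ℕ) (t : ℝ) :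
    ∫ s in (0 : ℝ)..(2 * π), dirichletKernel n (t - s) = π := by
  have h (j : ℕ) (hj : 1 ≤ j) : ∫ s in (0 : ℝ)..(2 * π), Real.cos (j * (t - s)) = 0 := by
    have h0 := integral_cos_mul_cos (i := 0) hj t t
    rw [if_neg (by omega)] at h0
    simpa using h0
  simp_rw [dirichletKernel]
  rw [intervalIntegral.integral_add (Continuous.intervalIntegrable (by fun_prop) _ _)
    (Continuous.intervalIntegrable (by fun_prop) _ _),
    intervalIntegral.integral_finsetSum
      fun i _ ↦ Continuous.intervalIntegrable (by fun_prop) _ _,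
    Finset.sum_eq_zero fun j hj ↦ h j (Finset.mem_Icc.mp hj).1]
  simp
  ring

theorem integral_dirichletKernel_mul_dirichletKernel {k n : ℕ} (hkn : k ≤ n) (x t : ℝ) :
    ∫ s in (0 : ℝ)..(2 * π), dirichletKernel k (x - s) * dirichletKernel n (t - s) =
      π * dirichletKernel k (x - t) := by
  have hD := continuous_dirichletKernel n
  rw [dirichletKernel.eq_1 k]
  simp_rw [dirichletKernel.eq_1 k, add_mul, Finset.sum_mul]
  rw [intervalIntegral.integral_add (Continuous.intervalIntegrable (by fun_prop) _ _)
    (Continuous.intervalIntegrable (by fun_prop) _ _), intervalIntegral.integral_const_mul,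
    integral_dirichletKernel_sub, intervalIntegral.integral_finsetSum
      fun i _ ↦ Continuous.intervalIntegrable (by fun_prop) _ _, mul_add, Finset.mul_sum]
  congr 1
  · ring
  · exact Finset.sum_congr rfl fun j hj ↦ integral_cos_mul_dirichletKernel
      (Finset.mem_Icc.mp hj).1 ((Finset.mem_Icc.mp hj).2.trans hkn) x t

theorem dirichletKernel_neg (n : ℕ) (u : ℝ) : dirichletKernel n (-u) = dirichletKernel n u := by
  simp [dirichletKernel]

theorem integral_partialFourierSum_mul {f h : ℝ → ℝ}
    (hf : IntervalIntegrable f volume 0 (2 * π)) (hh : IntervalIntegrable h volume 0 (2 * π))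
    (n : ℕ) :
    ∫ x in (0 : ℝ)..(2 * π), partialFourierSum f n x * h x =
      ∫ t in (0 : ℝ)..(2 * π), f t * partialFourierSum h n t := by
  have hD := continuous_dirichletKernel n
  have hi : Integrable (Function.uncurry fun x t ↦ h x * f t * dirichletKernel n (x - t))
      (periodMeasure.prod periodMeasure) := by
    exact Integrable.mul_bdd (c := n + 1 / 2) (hh.1.mul_prod hf.1)
      (by fun_prop : Continuous fun z : ℝ × ℝ ↦ dirichletKernel n (z.1 - z.2)).aestronglyMeasurable
      (Filter.Eventually.of_forall fun z ↦ abs_dirichletKernel_le n _)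
  have e1 (x : ℝ) : partialFourierSum f n x * h x =
      (1 / π) * ∫ t in (0 : ℝ)..(2 * π), h x * f t * dirichletKernel n (x - t) := by
    simp_rw [partialFourierSum, mul_assoc, intervalIntegral.integral_const_mul]
    ring
  have e2 (t : ℝ) : f t * partialFourierSum h n t =
      (1 / π) * ∫ x in (0 : ℝ)..(2 * π), h x * f t * dirichletKernel n (x - t) := by
    have (x : ℝ) : h x * f t * dirichletKernel n (x - t) =
        f t * (h x * dirichletKernel n (t - x)) := by
      rw [← dirichletKernel_neg, neg_sub]; ring
    simp_rw [this, partialFourierSum, intervalIntegral.integral_const_mul]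
    ring
  simp_rw [e1, e2, intervalIntegral.integral_const_mul]
  congr 1
  simp_rw [intervalIntegral.integral_of_le Real.two_pi_pos.le]
  exact integral_integral_swap hi

theorem partialFourierSum_partialFourierSum {f : ℝ → ℝ}
    (hf : IntervalIntegrable f volume 0 (2 * π)) {k n : ℕ} (hkn : k ≤ n) (x : ℝ) :
    partialFourierSum (partialFourierSum f k) n x = partialFourierSum f k x := by
  have hD := continuous_dirichletKernel n
  rw [partialFourierSum, integral_partialFourierSum_mul hf
    (Continuous.intervalIntegrable (by fun_prop) _ _), partialFourierSum.eq_1 f]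
  congr 1
  refine intervalIntegral.integral_congr fun t _ ↦ ?_
  have : partialFourierSum (fun t ↦ dirichletKernel n (x - t)) k t = dirichletKernel k (x - t) := by
    simp_rw [partialFourierSum, mul_comm (dirichletKernel n _)]
    rw [integral_dirichletKernel_mul_dirichletKernel hkn, ← dirichletKernel_neg, neg_sub]
    field_simp
  simp only [this]

theorem Continuous.memLp_periodMeasure {p : ℝ} (hp : 0 < p) {g : ℝ → ℝ} (hg : Continuous g) :
    MemLp g (ENNReal.ofReal p) periodMeasure := by
  refine ⟨hg.aestronglyMeasurable, ?_⟩
  have h := lintegral_enorm_rpow_eq_ofReal hp hg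
  rw [lintegral_enorm_rpow_eq_eLpNorm_rpow hp] at h
  exact (ENNReal.rpow_lt_top_iff_of_pos hp).mp (h ▸ ENNReal.ofReal_lt_top)

/-- Uniform `L^p` boundedness of partial Fourier sums. -/
theorem exists_eLpNorm_partialFourierSum_le {p : ℝ} (hp : 1 < p) :
    ∃ C : NNReal, ∀ (f : ℝ → ℝ) (n : ℕ), MemLp f (ENNReal.ofReal p) periodMeasure →
      eLpNorm (partialFourierSum f n) (ENNReal.ofReal p) periodMeasure ≤
        C * eLpNorm f (ENNReal.ofReal p) periodMeasure := by
  rcases le_or_gt p 2 with hp2 | hp2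
  · exact exists_eLpNorm_partialFourierSum_le_of_le_two hp hp2
  have hpq := Real.HolderConjugate.conjExponent hp
  set q := p.conjExponent with hq
  have hp0 : 0 < p := by linarith
  have hq1 : 1 < q := hpq.symm.lt
  have hq0 : 0 < q := by linarith
  have hqe : (p - 1) * q = p := hpq.sub_one_mul_conj
  have hq2 : q ≤ 2 := by nlinarith
  obtain ⟨C, hC⟩ := exists_eLpNorm_partialFourierSum_le_of_le_two hq1 hq2
  refine ⟨C, fun f n hf ↦ ?_⟩
  have hfi := hf.intervalIntegrable_period hp.le
  set g := partialFourierSum f n with hg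
  have hgc : Continuous g := continuous_partialFourierSum hfi n
  set h : ℝ → ℝ := fun x ↦ |g x| ^ (p - 2) * g x with hh
  have hhc : Continuous h :=
    (hgc.abs.rpow_const fun _ ↦ Or.inr (by linarith)).mul hgc
  have hgh (x : ℝ) : g x * h x = |g x| ^ p := by
    rcases eq_or_ne (g x) 0 with h0 | h0
    · simp [h0, Real.zero_rpow hp0.ne']
    · have : g x * h x = |g x| ^ (p - 2) * |g x| ^ (2 : ℝ) := by
        rw [Real.rpow_two, sq_abs, hh]; ring
      rw [this, ← Real.rpow_add (abs_pos.mpr h0)]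
      congr 1; ring
  have habs (x : ℝ) : |h x| ^ q = |g x| ^ p := by
    rcases eq_or_ne (g x) 0 with h0 | h0
    · simp [hh, h0, Real.zero_rpow hp0.ne', Real.zero_rpow hq0.ne']
    · have h1 : |h x| = |g x| ^ (p - 1) := by
        rw [hh, abs_mul, abs_of_nonneg (by positivity : 0 ≤ |g x| ^ (p - 2))]
        nth_rewrite 2 [← Real.rpow_one |g x|]
        rw [← Real.rpow_add (abs_pos.mpr h0)]
        congr 1; ring
      rw [h1, ← Real.rpow_mul (abs_nonneg _), hqe]
  have hhm : MemLp h (ENNReal.ofReal q) periodMeasure := hhc.memLp_periodMeasure hq0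
  have hSc : Continuous (partialFourierSum h n) :=
    continuous_partialFourierSum (hhc.intervalIntegrable _ _) n
  set G := eLpNorm g (ENNReal.ofReal p) periodMeasure with hG
  have hGtop : G ≠ ⊤ := (hgc.memLp_periodMeasure hp0).2.ne
  have hGh : eLpNorm h (ENNReal.ofReal q) periodMeasure = G ^ (p - 1) := by
    have h1 : eLpNorm h (ENNReal.ofReal q) periodMeasure ^ q = (G ^ (p - 1)) ^ q := by
      rw [← ENNReal.rpow_mul, hqe, ← lintegral_enorm_rpow_eq_eLpNorm_rpow hq0,
        ← lintegral_enorm_rpow_eq_eLpNorm_rpow hp0, lintegral_enorm_rpow_eq_ofReal hq0 hhc,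
        lintegral_enorm_rpow_eq_ofReal hp0 hgc]
      simp_rw [habs]
    exact ENNReal.rpow_left_injective hq0.ne' h1
  have key : G * G ^ (p - 1) ≤
      (C * eLpNorm f (ENNReal.ofReal p) periodMeasure) * G ^ (p - 1) := by
    calc G * G ^ (p - 1) = G ^ p := by
          nth_rewrite 1 [← ENNReal.rpow_one G]
          rw [← ENNReal.rpow_add_of_nonneg _ _ zero_le_one (by linarith)]
          congr 1; ring
      _ = ENNReal.ofReal (∫ x in (0 : ℝ)..(2 * π), g x * h x) := by
          rw [← lintegral_enorm_rpow_eq_eLpNorm_rpow hp0, lintegral_enorm_rpow_eq_ofReal hp0 hgc]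
          simp_rw [hgh]
      _ = ENNReal.ofReal (∫ x in (0 : ℝ)..(2 * π), f x * partialFourierSum h n x) := by
          rw [hg, integral_partialFourierSum_mul hfi (hhc.intervalIntegrable _ _)]
      _ ≤ ‖∫ x in (0 : ℝ)..(2 * π), f x * partialFourierSum h n x‖ₑ := by
          rw [Real.enorm_eq_ofReal_abs]
          exact ENNReal.ofReal_le_ofReal (le_abs_self _)
      _ ≤ ∫⁻ x, ‖f x‖ₑ * ‖partialFourierSum h n x‖ₑ ∂periodMeasure := by
          rw [intervalIntegral.integral_of_le Real.two_pi_pos.le]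
          refine (enorm_integral_le_lintegral_enorm _).trans_eq ?_
          simp_rw [enorm_mul]
      _ ≤ eLpNorm f (ENNReal.ofReal p) periodMeasure *
          eLpNorm (partialFourierSum h n) (ENNReal.ofReal q) periodMeasure := by
          have := ENNReal.lintegral_mul_le_Lp_mul_Lq periodMeasure hpq hf.1.enorm
            (hSc.aestronglyMeasurable (μ := periodMeasure)).enorm
          rwa [lintegral_enorm_rpow_eq_eLpNorm_rpow hp0, lintegral_enorm_rpow_eq_eLpNorm_rpow hq0,
            ← ENNReal.rpow_mul, ← ENNReal.rpow_mul, mul_one_div_cancel hp0.ne',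
            mul_one_div_cancel hq0.ne', ENNReal.rpow_one, ENNReal.rpow_one] at this
      _ ≤ eLpNorm f (ENNReal.ofReal p) periodMeasure * (C * G ^ (p - 1)) := by
          rw [← hGh]
          exact mul_le_mul' le_rfl (hC h n hhm)
      _ = _ := by ring
  rcases eq_or_ne G 0 with h0 | h0
  · rw [h0]; exact zero_le
  · refine (ENNReal.mul_le_mul_iff_left ?_ ?_).mp key
    · exact (ENNReal.rpow_pos (pos_iff_ne_zero.mpr h0) hGtop).ne'
    · exact ENNReal.rpow_ne_top_of_nonneg (by linarith) hGtop

/-- The Fejér kernel, normalized to have integral one over a period. -/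
noncomputable def fejerKernel (n : ℕ) (u : ℝ) : ℝ :=
  (1 / (π * (n + 1))) * ∑ k ∈ Finset.range (n + 1), dirichletKernel k u

/-- The arithmetic means of the partial Fourier sums. -/
noncomputable def fejerMean (f : ℝ → ℝ) (n : ℕ) (x : ℝ) : ℝ :=
  (1 / ((n : ℝ) + 1)) * ∑ k ∈ Finset.range (n + 1), partialFourierSum f k x

theorem continuous_fejerKernel (n : ℕ) : Continuous (fejerKernel n) :=
  continuous_const.mul (continuous_finsetSum _ fun k _ ↦ continuous_dirichletKernel k)

theorem periodic_dirichletKernel (n : ℕ) : Function.Periodic (dirichletKernel n) (2 * π) := by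
  intro u
  unfold dirichletKernel
  congr 1
  refine Finset.sum_congr rfl fun k _ ↦ ?_
  rw [mul_add, Real.cos_add_nat_mul_two_pi]

theorem periodic_fejerKernel (n : ℕ) : Function.Periodic (fejerKernel n) (2 * π) := by
  intro u
  simp_rw [fejerKernel, periodic_dirichletKernel _ u]

theorem sum_dirichletKernel_mul_one_sub_cos (n : ℕ) (u : ℝ) :
    2 * (∑ k ∈ Finset.range n, dirichletKernel k u) * (1 - Real.cos u) =
      1 - Real.cos (n * u) := by
  induction n with
  | zero => simp
  | succ n ih =>
    have := two_mul_dirichletKernel_mul_one_sub_cos n u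
    rw [Finset.sum_range_succ]
    push_cast
    linear_combination ih + this

theorem sum_dirichletKernel_le (n : ℕ) (u : ℝ) :
    ∑ k ∈ Finset.range n, dirichletKernel k u ≤ (n : ℝ) ^ 2 / 2 := by
  induction n with
  | zero => simp
  | succ n ih =>
    rw [Finset.sum_range_succ]
    push_cast
    nlinarith [(abs_le.mp (abs_dirichletKernel_le n u)).2]

theorem fejerKernel_nonneg (n : ℕ) (u : ℝ) : 0 ≤ fejerKernel n u := by
  refine mul_nonneg (by positivity) ?_
  have h := sum_dirichletKernel_mul_one_sub_cos (n + 1) u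
  rcases (Real.cos_le_one u).eq_or_lt with h1 | h1
  · obtain ⟨m, rfl⟩ := (Real.cos_eq_one_iff u).mp h1
    refine Finset.sum_nonneg fun k _ ↦ ?_
    unfold dirichletKernel
    refine add_nonneg (by norm_num) (Finset.sum_nonneg fun j _ ↦ ?_)
    have := Real.cos_int_mul_two_pi ((j : ℤ) * m)
    push_cast at this
    rw [← mul_assoc, this]
    norm_num
  · by_contra! h2
    nlinarith [Real.cos_le_one ((n + 1 : ℕ) * u), mul_pos (neg_pos.mpr h2) (sub_pos.mpr h1)]

theorem fejerKernel_le (n : ℕ) {u : ℝ} (hu : |u| ≤ π) :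
    fejerKernel n u ≤ (1 / (2 * π) + π / 2) * ((n + 1) / (1 + ((n + 1) * u) ^ 2)) := by
  have hpi := Real.pi_pos
  set S := ∑ k ∈ Finset.range (n + 1), dirichletKernel k u with hS
  have h1 : S ≤ ((n : ℝ) + 1) ^ 2 / 2 := by
    simpa using sum_dirichletKernel_le (n + 1) u
  have h0 : 0 ≤ S := by
    have := fejerKernel_nonneg n u
    rw [fejerKernel] at this
    exact (mul_nonneg_iff_of_pos_left (by positivity)).mp this
  have h2 : S * u ^ 2 ≤ π ^ 2 / 2 := by
    have h := sum_dirichletKernel_mul_one_sub_cos (n + 1) u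
    have hc := Real.cos_le_one_sub_mul_cos_sq hu
    have h3 : 2 * S * (2 / π ^ 2 * u ^ 2) ≤ 2 := by
      calc 2 * S * (2 / π ^ 2 * u ^ 2) ≤ 2 * S * (1 - Real.cos u) := by
            gcongr; linarith
        _ = _ := h
        _ ≤ 2 := by linarith [Real.neg_one_le_cos ((n + 1 : ℕ) * u)]
    have h4 : S * u ^ 2 = (2 * S * (2 / π ^ 2 * u ^ 2)) * (π ^ 2 / 4) := by field_simp; ring
    rw [h4]
    nlinarith [sq_nonneg π]
  rw [fejerKernel, ← hS, ← mul_div_assoc, le_div_iff₀ (by positivity)]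
  have h5 : S * (1 + ((n + 1) * u) ^ 2) ≤ ((n : ℝ) + 1) ^ 2 * (1 / 2 + π ^ 2 / 2) := by
    have : S * (1 + ((n + 1) * u) ^ 2) = S + ((n : ℝ) + 1) ^ 2 * (S * u ^ 2) := by ring
    rw [this]
    nlinarith [mul_le_mul_of_nonneg_left h2 (sq_nonneg ((n : ℝ) + 1))]
  calc 1 / (π * (n + 1)) * S * (1 + ((n + 1) * u) ^ 2)
      = 1 / (π * (n + 1)) * (S * (1 + ((n + 1) * u) ^ 2)) := by ring
    _ ≤ 1 / (π * (n + 1)) * (((n : ℝ) + 1) ^ 2 * (1 / 2 + π ^ 2 / 2)) := by gcongr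
    _ = _ := by field_simp

theorem integrable_rpow_abs_div_one_add_sq {α : ℝ} (hα0 : 0 ≤ α) (hα1 : α < 1) :
    Integrable fun v : ℝ ↦ |v| ^ α / (1 + v ^ 2) := by
  have h := integrable_rpow_neg_one_add_norm_sq (E := ℝ) (μ := volume) (r := 2 - α)
    (by simp; linarith)
  refine h.mono' ?_ (Filter.Eventually.of_forall fun v ↦ ?_)
  · apply Measurable.aestronglyMeasurable
    fun_prop
  · rw [Real.norm_of_nonneg (by positivity)]
    have e : -(2 - α) / 2 = α / 2 - 1 := by ring
    rw [Real.norm_eq_abs, sq_abs, e, Real.rpow_sub_one (by positivity)]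
    gcongr
    calc |v| ^ α = (v ^ 2) ^ (α / 2) := by
          rw [← sq_abs, ← Real.rpow_natCast, ← Real.rpow_mul (abs_nonneg _)]
          congr 1; push_cast; ring
      _ ≤ _ := Real.rpow_le_rpow (sq_nonneg _) (by linarith) (by linarith)

theorem exists_lintegral_rpow_mul_fejerKernel_le {α : ℝ} (hα0 : 0 ≤ α) (hα1 : α < 1) :
    ∃ C : ℝ, 0 ≤ C ∧ ∀ n : ℕ,
      ∫⁻ s in Set.Ioc (-π) π, ENNReal.ofReal (|s| ^ α) * ENNReal.ofReal (fejerKernel n s) ≤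
        ENNReal.ofReal (C * ((n : ℝ) + 1) ^ (-α)) := by
  set φ : ℝ → ℝ := fun v ↦ |v| ^ α / (1 + v ^ 2) with hφ
  have hφi : Integrable φ := integrable_rpow_abs_div_one_add_sq hα0 hα1
  have hφ0 (v : ℝ) : 0 ≤ φ v := by simp only [hφ]; positivity
  set c := 1 / (2 * π) + π / 2 with hc
  have hc0 : 0 ≤ c := by have := Real.pi_pos; positivity
  refine ⟨c * ∫ v, φ v, mul_nonneg hc0 (integral_nonneg hφ0), fun n ↦ ?_⟩
  have hN : (0 : ℝ) < n + 1 := by positivity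
  have hle : ∀ s ∈ Set.Ioc (-π) π,
      ENNReal.ofReal (|s| ^ α) * ENNReal.ofReal (fejerKernel n s) ≤
        ENNReal.ofReal (c * ((n : ℝ) + 1) ^ (1 - α) * φ ((n + 1) * s)) := by
    intro s hs
    rw [← ENNReal.ofReal_mul (by positivity)]
    apply ENNReal.ofReal_le_ofReal
    calc |s| ^ α * fejerKernel n s
        ≤ |s| ^ α * (c * ((n + 1) / (1 + ((n + 1) * s) ^ 2))) := by
          gcongr
          exact fejerKernel_le n (abs_le.mpr ⟨hs.1.le, hs.2⟩)
      _ = _ := by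
          simp only [hφ]
          rw [abs_mul, abs_of_pos hN, Real.mul_rpow hN.le (abs_nonneg _), Real.rpow_sub hN,
            Real.rpow_one]
          have := (Real.rpow_pos_of_pos hN α).ne'
          field_simp
  calc ∫⁻ s in Set.Ioc (-π) π, ENNReal.ofReal (|s| ^ α) * ENNReal.ofReal (fejerKernel n s)
      ≤ ∫⁻ s in Set.Ioc (-π) π,
          ENNReal.ofReal (c * ((n : ℝ) + 1) ^ (1 - α) * φ ((n + 1) * s)) :=
        setLIntegral_mono' measurableSet_Ioc hle
    _ ≤ ∫⁻ s, ENNReal.ofReal (c * ((n : ℝ) + 1) ^ (1 - α) * φ ((n + 1) * s)) :=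
        setLIntegral_le_lintegral _ _
    _ = ENNReal.ofReal (∫ s, c * ((n : ℝ) + 1) ^ (1 - α) * φ ((n + 1) * s)) := by
        rw [ofReal_integral_eq_lintegral_ofReal]
        · exact (hφi.comp_mul_left' hN.ne').const_mul _
        · exact Filter.Eventually.of_forall fun s ↦ by have := hφ0 ((n + 1) * s); positivity
    _ = _ := by
        rw [integral_const_mul, Measure.integral_comp_mul_left, abs_of_pos (by positivity),
          smul_eq_mul, Real.rpow_sub hN, Real.rpow_one, Real.rpow_neg hN.le]
        congr 1
        field_simp

theorem Function.Periodic.aestronglyMeasurable {f : ℝ → ℝ} {T : ℝ} (hf : Function.Periodic f T)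
    (hT : T ≠ 0) (hfi : IntervalIntegrable f volume 0 T) : AEStronglyMeasurable f volume := by
  refine LocallyIntegrable.aestronglyMeasurable fun x ↦ ?_
  refine ⟨Set.Ioc (x - 1) (x + 1), Ioc_mem_nhds (by linarith) (by linarith), ?_⟩
  exact (hf.intervalIntegrable₀ hT hfi _ _).1

theorem memLp_periodMeasure_iff {p : ℝ} (hp : 0 < p) {f : ℝ → ℝ}
    (hf : AEStronglyMeasurable f periodMeasure) :
    MemLp f (ENNReal.ofReal p) periodMeasure ↔
      IntervalIntegrable (fun x ↦ |f x| ^ p) volume 0 (2 * π) := by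
  rw [intervalIntegrable_iff_integrableOn_Ioc_of_le Real.two_pi_pos.le, IntegrableOn,
    ← integrable_norm_rpow_iff hf (by simpa using hp) ENNReal.ofReal_ne_top,
    ENNReal.toReal_ofReal hp.le]
  rfl

theorem ofReal_lpNorm_eq {p : ℝ} (hp : 0 < p) {f : ℝ → ℝ}
    (hf : MemLp f (ENNReal.ofReal p) periodMeasure) :
    ENNReal.ofReal (_root_.lpNorm p f) =
      ENNReal.ofReal ((1 / (2 * π)) ^ (1 / p)) * eLpNorm f (ENNReal.ofReal p) periodMeasure := by
  have hpi := Real.two_pi_pos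
  rw [hf.eLpNorm_eq_integral_rpow_norm (by simpa using hp) ENNReal.ofReal_ne_top,
    ENNReal.toReal_ofReal hp.le, ← ENNReal.ofReal_mul (by positivity), _root_.lpNorm,
    intervalIntegral.integral_of_le hpi.le, Real.mul_rpow (by positivity)
      (integral_nonneg fun x ↦ by positivity), one_div p]
  rfl

theorem lpNorm_le_iff {p : ℝ} (hp : 0 < p) {f : ℝ → ℝ}
    (hf : MemLp f (ENNReal.ofReal p) periodMeasure) {c : ℝ} (hc : 0 ≤ c) :
    _root_.lpNorm p f ≤ c ↔
      eLpNorm f (ENNReal.ofReal p) periodMeasure ≤ ENNReal.ofReal ((2 * π) ^ (1 / p) * c) := by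
  have hpi := Real.two_pi_pos
  have h1 : 0 < (2 * π) ^ (1 / p) := by positivity
  rw [← ENNReal.ofReal_le_ofReal_iff hc, ofReal_lpNorm_eq hp hf, one_div (2 * π),
    Real.inv_rpow hpi.le, ENNReal.ofReal_inv_of_pos h1, ENNReal.ofReal_mul h1.le, mul_comm,
    ← div_eq_mul_inv, ENNReal.div_le_iff_le_mul (Or.inl (by simpa using h1))
      (Or.inl ENNReal.ofReal_ne_top), mul_comm]

theorem memLp_comp_add {p : ℝ} (hp : 0 < p) {f : ℝ → ℝ} (hf : Function.Periodic f (2 * π))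
    (hfi : IntervalIntegrable f volume 0 (2 * π))
    (hfp : MemLp f (ENNReal.ofReal p) periodMeasure) (h : ℝ) :
    MemLp (fun x ↦ f (x + h)) (ENNReal.ofReal p) periodMeasure ∧
      eLpNorm (fun x ↦ f (x + h)) (ENNReal.ofReal p) periodMeasure =
        eLpNorm f (ENNReal.ofReal p) periodMeasure := by
  have hpi := Real.two_pi_pos
  have hper : Function.Periodic (fun x ↦ |f x| ^ p) (2 * π) := fun x ↦ by simp only [hf x]
  have hm : AEStronglyMeasurable (fun x ↦ f (x + h)) periodMeasure :=
    ((hf.aestronglyMeasurable hpi.ne' hfi).comp_quasiMeasurePreserving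
      (measurePreserving_add_right volume h).quasiMeasurePreserving).restrict
  have hi := (memLp_periodMeasure_iff hp hfp.1).mp hfp
  have hL : MemLp (fun x ↦ f (x + h)) (ENNReal.ofReal p) periodMeasure := by
    rw [memLp_periodMeasure_iff hp hm]
    have := (hper.intervalIntegrable₀ hpi.ne' hi h (2 * π + h)).comp_add_right h
    simpa using this
  refine ⟨hL, ?_⟩
  rw [hL.eLpNorm_eq_integral_rpow_norm (by simpa using hp) ENNReal.ofReal_ne_top,
    hfp.eLpNorm_eq_integral_rpow_norm (by simpa using hp) ENNReal.ofReal_ne_top,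
    ENNReal.toReal_ofReal hp.le]
  congr 2
  simp_rw [← intervalIntegral.integral_of_le hpi.le, Real.norm_eq_abs]
  rw [intervalIntegral.integral_comp_add_right (fun x ↦ |f x| ^ p)]
  simpa [add_comm] using hper.intervalIntegral_add_eq h 0

theorem LipClass.memLp {α p : ℝ} (hp : 0 < p) {f : ℝ → ℝ} (hf : LipClass α p f) :
    MemLp f (ENNReal.ofReal p) periodMeasure :=
  (memLp_periodMeasure_iff hp hf.2.1.1.aestronglyMeasurable).mpr hf.2.2.1

theorem LipClass.exists_eLpNorm_sub_le {α p : ℝ} (hp : 1 ≤ p) {f : ℝ → ℝ}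
    (hf : LipClass α p f) :
    ∃ L : ℝ, 0 ≤ L ∧ ∀ h : ℝ, h ≠ 0 →
      eLpNorm (fun x ↦ f (x + h) - f x) (ENNReal.ofReal p) periodMeasure ≤
        ENNReal.ofReal (L * |h| ^ α) := by
  have hp0 : 0 < p := by linarith
  have hfp := hf.memLp hp0
  obtain ⟨hper, hfi, -, C, hC0, hC⟩ := hf
  refine ⟨(2 * π) ^ (1 / p) * C, by have := Real.two_pi_pos; positivity, fun h hh ↦ ?_⟩
  have hM (s : ℝ) : MemLp (fun x ↦ f (x + s) - f x) (ENNReal.ofReal p) periodMeasure :=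
    (memLp_comp_add hp0 hper hfi hfp s).1.sub hfp
  have hbdd : BddAbove {y : ℝ | ∃ s : ℝ, 0 < |s| ∧ |s| ≤ |h| ∧
      y = ((1 / (2 * π)) * ∫ x in (0 : ℝ)..(2 * π), |f (x + s) - f x| ^ p) ^ (1 / p)} := by
    set F := eLpNorm f (ENNReal.ofReal p) periodMeasure with hF
    have hFtop : F ≠ ⊤ := hfp.2.ne
    refine ⟨((2 * π) ^ (1 / p))⁻¹ * (F + F).toReal, ?_⟩
    rintro y ⟨s, -, -, rfl⟩
    have hpi := Real.two_pi_pos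
    refine (lpNorm_le_iff hp0 (hM s) (by positivity)).mpr ?_
    rw [mul_inv_cancel_left₀ (by positivity), ENNReal.ofReal_toReal (by finiteness)]
    refine (eLpNorm_sub_le (memLp_comp_add hp0 hper hfi hfp s).1.1 hfp.1
      (by simpa using hp)).trans_eq ?_
    rw [(memLp_comp_add hp0 hper hfi hfp s).2]
  have h1 : _root_.lpNorm p (fun x ↦ f (x + h) - f x) ≤ C * |h| ^ α :=
    (le_csSup hbdd ⟨h, abs_pos.mpr hh, le_rfl, rfl⟩).trans (hC _ (abs_pos.mpr hh))
  rw [mul_assoc]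
  exact (lpNorm_le_iff hp0 (hM h) (by positivity)).mp h1

theorem lintegral_rpow_lintegral_mul_le {ν₁ ν₂ : Measure ℝ} [SFinite ν₁] [SFinite ν₂]
    {p : ℝ} (hp : 1 ≤ p) {G : ℝ → ℝ → ENNReal}
    (hG : AEMeasurable (Function.uncurry G) (ν₁.prod ν₂)) {φ k : ℝ → ENNReal}
    (hφ : Measurable φ) (hk : Measurable k) (hφ0 : ∀ᵐ s ∂ν₂, φ s ≠ 0) (hφtop : ∀ s, φ s ≠ ⊤)
    {c : ENNReal} (h : ∀ᵐ s ∂ν₂, ∫⁻ x, G x s ^ p ∂ν₁ ≤ c * φ s ^ p) :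
    ∫⁻ x, (∫⁻ s, G x s * k s ∂ν₂) ^ p ∂ν₁ ≤ c * (∫⁻ s, φ s * k s ∂ν₂) ^ p := by
  have hp0 : 0 < p := by linarith
  set W := ∫⁻ s, φ s * k s ∂ν₂ with hW
  set w : ℝ → ENNReal := fun s ↦ φ s * k s with hw
  have hwm : Measurable w := hφ.mul hk
  have hGm : AEMeasurable (fun z : ℝ × ℝ ↦ w z.2 * (G z.1 z.2 / φ z.2) ^ p) (ν₁.prod ν₂) :=
    (hwm.comp measurable_snd).aemeasurable.mul
      ((hG.div (hφ.comp measurable_snd).aemeasurable).pow_const p)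
  have hx : ∀ᵐ x ∂ν₁, (∫⁻ s, G x s * k s ∂ν₂) ^ p ≤
      W ^ (p - 1) * ∫⁻ s, w s * (G x s / φ s) ^ p ∂ν₂ := by
    filter_upwards [hG.aestronglyMeasurable.prodMk_left] with x hGx
    have hGx : AEMeasurable (fun s ↦ G x s / φ s) ν₂ :=
      AEMeasurable.div hGx.aemeasurable hφ.aemeasurable
    have h1 := lintegral_rpow_le_mul_lintegral_rpow hp
      (hGx.mono_ac (withDensity_absolutelyContinuous ν₂ w))
    rw [lintegral_withDensity_eq_lintegral_mul₀ hwm.aemeasurable hGx,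
      lintegral_withDensity_eq_lintegral_mul₀ hwm.aemeasurable (hGx.pow_const p),
      withDensity_apply _ MeasurableSet.univ, Measure.restrict_univ] at h1
    refine le_trans (le_of_eq ?_) h1
    congr 1
    refine lintegral_congr_ae ?_
    filter_upwards [hφ0] with s hs
    simp only [Pi.mul_apply, hw]
    rw [mul_right_comm, ENNReal.mul_div_cancel hs (hφtop s)]
  calc ∫⁻ x, (∫⁻ s, G x s * k s ∂ν₂) ^ p ∂ν₁
      ≤ ∫⁻ x, W ^ (p - 1) * ∫⁻ s, w s * (G x s / φ s) ^ p ∂ν₂ ∂ν₁ := lintegral_mono_ae hx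
    _ = W ^ (p - 1) * ∫⁻ x, ∫⁻ s, w s * (G x s / φ s) ^ p ∂ν₂ ∂ν₁ :=
        lintegral_const_mul'' _ hGm.lintegral_prod_right'
    _ = W ^ (p - 1) * ∫⁻ s, ∫⁻ x, w s * (G x s / φ s) ^ p ∂ν₁ ∂ν₂ := by
        rw [lintegral_lintegral_swap hGm]
    _ ≤ W ^ (p - 1) * ∫⁻ s, c * w s ∂ν₂ := by
        refine mul_le_mul' le_rfl (lintegral_mono_ae ?_)
        filter_upwards [h, hφ0, hG.prod_swap.aestronglyMeasurable.prodMk_left] with s hs hs0 hGs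
        have hGs : AEMeasurable (fun x ↦ G x s ^ p) ν₁ := AEMeasurable.pow_const hGs.aemeasurable p
        have e : ∀ x, w s * (G x s / φ s) ^ p = (w s * ((φ s) ^ p)⁻¹) * G x s ^ p := fun x ↦ by
          rw [ENNReal.div_rpow_of_nonneg _ _ hp0.le, div_eq_mul_inv]; ring
        simp_rw [e]
        rw [lintegral_const_mul'' _ hGs]
        calc w s * (φ s ^ p)⁻¹ * ∫⁻ x, G x s ^ p ∂ν₁
            ≤ w s * (φ s ^ p)⁻¹ * (c * φ s ^ p) := by gcongr
          _ = c * w s * (φ s ^ p * (φ s ^ p)⁻¹) := by ring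
          _ = c * w s := by
            rw [ENNReal.mul_inv_cancel, mul_one]
            · exact (ENNReal.rpow_pos (pos_iff_ne_zero.mpr hs0) (hφtop s)).ne'
            · exact ENNReal.rpow_ne_top_of_nonneg hp0.le (hφtop s)
    _ = c * (W ^ (p - 1) * W ^ (1 : ℝ)) := by
        rw [lintegral_const_mul _ hwm, ENNReal.rpow_one]; ring
    _ = c * W ^ p := by
        rw [← ENNReal.rpow_add_of_nonneg _ _ (by linarith) zero_le_one]
        congr 2; ring

theorem fejerMean_eq {f : ℝ → ℝ} (hfi : IntervalIntegrable f volume 0 (2 * π)) (n : ℕ) (x : ℝ) :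
    fejerMean f n x = ∫ t in (0 : ℝ)..(2 * π), f t * fejerKernel n (x - t) := by
  have e : ∀ t, f t * fejerKernel n (x - t) = (1 / (π * (n + 1))) *
      ∑ k ∈ Finset.range (n + 1), f t * dirichletKernel k (x - t) := fun t ↦ by
    rw [fejerKernel, ← Finset.mul_sum]; ring
  simp_rw [e]
  rw [intervalIntegral.integral_const_mul, intervalIntegral.integral_finsetSum]
  · simp_rw [fejerMean, partialFourierSum]
    rw [← Finset.mul_sum]
    field_simp
  · intro k _
    exact hfi.mul_continuousOn ((continuous_dirichletKernel k).comp
      (continuous_const.sub continuous_id)).continuousOn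

theorem integral_fejerKernel_sub (n : ℕ) (x : ℝ) :
    ∫ t in (0 : ℝ)..(2 * π), fejerKernel n (x - t) = 1 := by
  simp_rw [fejerKernel]
  rw [intervalIntegral.integral_const_mul, intervalIntegral.integral_finsetSum]
  · simp_rw [integral_dirichletKernel_sub]
    have := Real.pi_pos
    simp
    field_simp
  · intro k _
    exact ((continuous_dirichletKernel k).comp
      (continuous_const.sub continuous_id)).intervalIntegrable _ _

theorem fejerMean_sub_eq {f : ℝ → ℝ} (hf : Function.Periodic f (2 * π))
    (hfi : IntervalIntegrable f volume 0 (2 * π)) (n : ℕ) (x : ℝ) :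
    fejerMean f n x - f x =
      ∫ s in (-π)..π, (f (x - s) - f x) * fejerKernel n s := by
  have hF : Continuous fun t ↦ fejerKernel n (x - t) :=
    (continuous_fejerKernel n).comp (continuous_const.sub continuous_id)
  have h1 : fejerMean f n x - f x =
      ∫ t in (0 : ℝ)..(2 * π), (f t - f x) * fejerKernel n (x - t) := by
    simp_rw [sub_mul]
    rw [intervalIntegral.integral_sub (hfi.mul_continuousOn hF.continuousOn)
      ((hF.intervalIntegrable _ _).const_mul _), intervalIntegral.integral_const_mul,
      integral_fejerKernel_sub, fejerMean_eq hfi, mul_one]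
  have hper : Function.Periodic (fun t ↦ (f t - f x) * fejerKernel n (x - t)) (2 * π) := by
    intro t
    simp only [hf t]
    rw [← periodic_fejerKernel n (x - (t + 2 * π))]
    congr 2; ring
  have h2 := hper.intervalIntegral_add_eq 0 (x - π)
  rw [zero_add, show x - π + 2 * π = x + π by ring] at h2
  rw [h1, h2]
  have h3 := intervalIntegral.integral_comp_sub_left (a := -π) (b := π)
    (fun t ↦ (f t - f x) * fejerKernel n (x - t)) x
  simp only [sub_sub_cancel, sub_neg_eq_add] at h3
  exact h3.symm

theorem LipClass.exists_eLpNorm_fejerMean_sub_le {α p : ℝ} (hp : 1 ≤ p) (hα0 : 0 ≤ α)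
    (hα1 : α < 1) {f : ℝ → ℝ} (hf : LipClass α p f) :
    ∃ C : ℝ, 0 ≤ C ∧ ∀ n : ℕ,
      eLpNorm (fun x ↦ fejerMean f n x - f x) (ENNReal.ofReal p) periodMeasure ≤
        ENNReal.ofReal (C * ((n : ℝ) + 1) ^ (-α)) := by
  have hp0 : 0 < p := by linarith
  have hpi := Real.pi_pos
  obtain ⟨L, hL0, hL⟩ := hf.exists_eLpNorm_sub_le hp
  obtain ⟨B, hB0, hB⟩ := exists_lintegral_rpow_mul_fejerKernel_le hα0 hα1
  obtain ⟨hper, hfi, -, -⟩ := hf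
  have hfm : AEStronglyMeasurable f volume := hper.aestronglyMeasurable Real.two_pi_pos.ne' hfi
  refine ⟨L * B, by positivity, fun n ↦ ?_⟩
  rw [← ENNReal.rpow_le_rpow_iff hp0, ← lintegral_enorm_rpow_eq_eLpNorm_rpow hp0]
  set ν₂ : Measure ℝ := volume.restrict (Set.Ioc (-π) π) with hν
  have hG : AEMeasurable (Function.uncurry fun x s ↦ ‖f (x - s) - f x‖ₑ)
      (periodMeasure.prod ν₂) := by
    have h1 : AEStronglyMeasurable (fun z : ℝ × ℝ ↦ f (z.1 - z.2) - f z.1)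
        ((volume : Measure ℝ).prod volume) :=
      (hfm.comp_quasiMeasurePreserving
        (quasiMeasurePreserving_sub_of_right_invariant volume volume)).sub hfm.comp_fst
    rw [hν, Measure.prod_restrict]
    exact h1.enorm.restrict
  have hae : ∀ᵐ s ∂ν₂, s ≠ 0 := ae_restrict_of_ae (Measure.ae_ne volume 0)
  have key := lintegral_rpow_lintegral_mul_le hp hG
    (φ := fun s ↦ ENNReal.ofReal (|s| ^ α)) (k := fun s ↦ ENNReal.ofReal (fejerKernel n s))
    (by fun_prop) (continuous_fejerKernel n).measurable.ennreal_ofReal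
    (by
      filter_upwards [hae] with s hs
      have : 0 < |s| := abs_pos.mpr hs
      simp only [ne_eq, ENNReal.ofReal_eq_zero, not_le]
      positivity) (fun s ↦ ENNReal.ofReal_ne_top)
    (c := ENNReal.ofReal L ^ p)
    (by
      filter_upwards [hae] with s hs
      rw [lintegral_enorm_rpow_eq_eLpNorm_rpow hp0, ← ENNReal.mul_rpow_of_nonneg _ _ hp0.le,
        ← ENNReal.ofReal_mul hL0]
      have := hL (-s) (neg_ne_zero.mpr hs)
      rw [abs_neg] at this
      gcongr
      exact this)
  calc ∫⁻ x, ‖fejerMean f n x - f x‖ₑ ^ p ∂periodMeasure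
      ≤ ∫⁻ x, (∫⁻ s, ‖f (x - s) - f x‖ₑ * ENNReal.ofReal (fejerKernel n s) ∂ν₂) ^ p
          ∂periodMeasure := by
        refine lintegral_mono fun x ↦ ?_
        dsimp only
        gcongr
        rw [fejerMean_sub_eq hper hfi, intervalIntegral.integral_of_le (by linarith)]
        refine (enorm_integral_le_lintegral_enorm _).trans_eq (lintegral_congr fun s ↦ ?_)
        rw [enorm_mul, Real.enorm_of_nonneg (fejerKernel_nonneg n s)]
    _ ≤ _ := key
    _ ≤ ENNReal.ofReal L ^ p * ENNReal.ofReal (B * ((n : ℝ) + 1) ^ (-α)) ^ p := by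
        gcongr
        exact hB n
    _ = _ := by
        rw [← ENNReal.mul_rpow_of_nonneg _ _ hp0.le, ← ENNReal.ofReal_mul hL0, mul_assoc]

theorem continuous_fejerMean {f : ℝ → ℝ} (hfi : IntervalIntegrable f volume 0 (2 * π)) (n : ℕ) :
    Continuous (fejerMean f n) :=
  continuous_const.mul (continuous_finsetSum _ fun k _ ↦ continuous_partialFourierSum hfi k)

theorem partialFourierSum_fejerMean {f : ℝ → ℝ} (hfi : IntervalIntegrable f volume 0 (2 * π))
    (n : ℕ) (x : ℝ) : partialFourierSum (fejerMean f n) n x = fejerMean f n x := by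
  have hD : Continuous fun t ↦ dirichletKernel n (x - t) :=
    (continuous_dirichletKernel n).comp (continuous_const.sub continuous_id)
  rw [fejerMean, ← Finset.sum_congr rfl fun k hk ↦ partialFourierSum_partialFourierSum hfi
    (Finset.mem_range_succ_iff.mp hk) x]
  simp_rw [partialFourierSum.eq_1 _ n, fejerMean, mul_assoc, Finset.sum_mul]
  rw [intervalIntegral.integral_const_mul, intervalIntegral.integral_finsetSum, ← Finset.mul_sum]
  · ring
  · exact fun k _ ↦ ((continuous_partialFourierSum hfi k).mul hD).intervalIntegrable _ _

theorem partialFourierSum_sub {f g : ℝ → ℝ} (hf : IntervalIntegrable f volume 0 (2 * π))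
    (hg : IntervalIntegrable g volume 0 (2 * π)) (n : ℕ) (x : ℝ) :
    partialFourierSum (fun t ↦ f t - g t) n x =
      partialFourierSum f n x - partialFourierSum g n x := by
  have hD : Continuous fun t ↦ dirichletKernel n (x - t) :=
    (continuous_dirichletKernel n).comp (continuous_const.sub continuous_id)
  simp_rw [partialFourierSum, sub_mul]
  rw [intervalIntegral.integral_sub (hf.mul_continuousOn hD.continuousOn)
    (hg.mul_continuousOn hD.continuousOn), mul_sub]

theorem LipClass.exists_eLpNorm_partialFourierSum_sub_le {α p : ℝ} (hp : 1 < p) (hα0 : 0 ≤ α)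
    (hα1 : α < 1) {f : ℝ → ℝ} (hf : LipClass α p f) :
    ∃ C : ℝ, 0 ≤ C ∧ ∀ n : ℕ,
      eLpNorm (fun x ↦ partialFourierSum f n x - f x) (ENNReal.ofReal p) periodMeasure ≤
        ENNReal.ofReal (C * ((n : ℝ) + 1) ^ (-α)) := by
  have hp0 : 0 < p := by linarith
  obtain ⟨B, hB0, hB⟩ := hf.exists_eLpNorm_fejerMean_sub_le hp.le hα0 hα1
  obtain ⟨A, hA⟩ := exists_eLpNorm_partialFourierSum_le hp
  have hfp := hf.memLp hp0
  have hfi := hf.2.1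
  refine ⟨(A + 1) * B, by positivity, fun n ↦ ?_⟩
  have hσ := continuous_fejerMean hfi n
  have hm : MemLp (fun x ↦ fejerMean f n x - f x) (ENNReal.ofReal p) periodMeasure :=
    (hσ.memLp_periodMeasure hp0).sub hfp
  have he : (fun x ↦ partialFourierSum f n x - f x) =
      (fun x ↦ fejerMean f n x - f x) -
        partialFourierSum (fun x ↦ fejerMean f n x - f x) n := by
    funext x
    rw [Pi.sub_apply, partialFourierSum_sub (hσ.intervalIntegrable _ _) hfi,
      partialFourierSum_fejerMean hfi]
    ring
  rw [he]
  refine (eLpNorm_sub_le hm.1 (continuous_partialFourierSum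
    (hm.intervalIntegrable_period hp.le) n).aestronglyMeasurable (by simpa using hp.le)).trans ?_
  calc _ ≤ ENNReal.ofReal (B * ((n : ℝ) + 1) ^ (-α)) +
        A * ENNReal.ofReal (B * ((n : ℝ) + 1) ^ (-α)) :=
        add_le_add (hB n) ((hA _ n hm).trans (mul_le_mul' le_rfl (hB n)))
    _ = _ := by
        rw [← ENNReal.ofReal_coe_nnreal, ← ENNReal.ofReal_mul A.coe_nonneg,
          ← ENNReal.ofReal_add (by positivity) (by positivity)]
        congr 1; ring

/-- Comparison of weighted sums against antitone weights by means of partial sums. -/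
theorem sum_mul_le_mul_sum_of_antitone {u b : ℕ → ℝ} {c : ℝ} {N : ℕ} (hb : Antitone b)
    (hb0 : ∀ k, 0 ≤ b k) (h : ∀ m ≤ N, ∑ k ∈ Finset.range m, u k ≤ c * m) :
    ∑ k ∈ Finset.range N, u k * b k ≤ c * ∑ k ∈ Finset.range N, b k := by
  have key : ∀ m ≤ N, ∑ k ∈ Finset.range m, u k * b k - c * ∑ k ∈ Finset.range m, b k ≤
      b m * (∑ k ∈ Finset.range m, u k - c * m) := by
    intro m
    induction m with
    | zero => simp
    | succ m ih =>
      intro hm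
      have h1 := ih (by omega)
      have h2 := h (m + 1) hm
      simp_rw [Finset.sum_range_succ] at h2 ⊢
      push_cast at h2 ⊢
      nlinarith [mul_nonneg (sub_nonneg.mpr (hb m.le_succ)) (sub_nonneg.mpr h2)]
  nlinarith [key N le_rfl, mul_nonneg (hb0 N) (sub_nonneg.mpr (h N le_rfl))]

theorem sum_range_rpow_neg_le {α : ℝ} (hα0 : 0 ≤ α) (hα1 : α < 1) (N : ℕ) :
    ∑ k ∈ Finset.range N, ((k : ℝ) + 1) ^ (-α) ≤ (N : ℝ) ^ (1 - α) / (1 - α) := by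
  have h1 : 0 < 1 - α := by linarith
  induction N with
  | zero => simp [Real.zero_rpow h1.ne']
  | succ N ih =>
    rw [Finset.sum_range_succ]
    have hN : (0 : ℝ) < N + 1 := by positivity
    have hs : -1 ≤ -(1 / ((N : ℝ) + 1)) := by
      rw [neg_le_neg_iff, div_le_one hN]
      linarith [(Nat.cast_nonneg N : (0 : ℝ) ≤ N)]
    have hB := rpow_one_add_le_one_add_mul_self hs h1.le (by linarith : 1 - α ≤ 1)
    have e : (N : ℝ) = (N + 1) * (1 + -(1 / ((N : ℝ) + 1))) := by field_simp; ring
    have h2 : (N : ℝ) ^ (1 - α) ≤ ((N : ℝ) + 1) ^ (1 - α) - (1 - α) * ((N : ℝ) + 1) ^ (-α) := by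
      nth_rewrite 1 [e]
      rw [Real.mul_rpow hN.le (by linarith)]
      calc _ ≤ ((N : ℝ) + 1) ^ (1 - α) * (1 + (1 - α) * -(1 / ((N : ℝ) + 1))) := by gcongr
        _ = _ := by
          have : ((N : ℝ) + 1) ^ (-α) = ((N : ℝ) + 1) ^ (1 - α) / (N + 1) := by
            rw [← Real.rpow_sub_one hN.ne']; congr 1; ring
          rw [this]; field_simp; ring
    push_cast
    rw [le_div_iff₀ h1] at ih ⊢
    nlinarith

theorem exists_sum_mul_rpow_neg_le {α : ℝ} (hα0 : 0 ≤ α) (hα1 : α < 1) {a : ℕ → ℕ → ℝ}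
    (hpos : ∀ n k, k ≤ n → 0 ≤ a n k)
    (hAMDMS : ∃ K : ℝ, ∀ n l m : ℕ, l ≤ m → m ≤ n → rowMean a n m ≤ K * rowMean a n l)
    (hO : ∃ C : ℝ, ∀ n : ℕ, ((n : ℝ) + 1) * a n 0 ≤ C) :
    ∃ M : ℝ, 0 ≤ M ∧ ∀ n : ℕ,
      ∑ k ∈ Finset.range (n + 1), a n k * ((k : ℝ) + 1) ^ (-α) ≤ M * ((n : ℝ) + 1) ^ (-α) := by
  obtain ⟨K, hK⟩ := hAMDMS
  obtain ⟨C, hC⟩ := hO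
  have h1 : 0 < 1 - α := by linarith
  have hC0 : 0 ≤ C := le_trans (by simpa using hpos 0 0 le_rfl) (hC 0)
  refine ⟨|K| * C / (1 - α), by positivity, fun n ↦ ?_⟩
  have hN : (0 : ℝ) < n + 1 := by positivity
  have hb : Antitone fun k : ℕ ↦ ((k : ℝ) + 1) ^ (-α) := fun i j hij ↦
    Real.rpow_le_rpow_of_nonpos (by positivity) (by gcongr) (by linarith)
  have hpart : ∀ m ≤ n + 1, ∑ k ∈ Finset.range m, a n k ≤ |K| * C / (n + 1) * m := by
    rintro (_ | m) hm
    · simp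
    have h := hK n 0 m (Nat.zero_le _) (by omega)
    simp only [rowMean, Nat.cast_zero, zero_add, Finset.sum_range_one, div_one, one_mul] at h
    rw [one_div, inv_mul_le_iff₀ (by positivity)] at h
    have ha0 := hpos n 0 (Nat.zero_le _)
    have ha : a n 0 ≤ C / (n + 1) := by
      rw [le_div_iff₀ hN, mul_comm]; exact hC n
    calc _ ≤ _ := h
      _ ≤ ((m : ℝ) + 1) * (|K| * (C / (n + 1))) := by
        gcongr
        exact le_abs_self K
      _ = _ := by push_cast; ring
  calc _ ≤ |K| * C / (n + 1) * ∑ k ∈ Finset.range (n + 1), ((k : ℝ) + 1) ^ (-α) :=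
        sum_mul_le_mul_sum_of_antitone hb (fun k ↦ by positivity) hpart
    _ ≤ |K| * C / (n + 1) * (((n : ℝ) + 1) ^ (1 - α) / (1 - α)) := by
        gcongr
        simpa using sum_range_rpow_neg_le hα0 hα1 (n + 1)
    _ = _ := by
        have : ((n : ℝ) + 1) ^ (-α) = ((n : ℝ) + 1) ^ (1 - α) / (n + 1) := by
          rw [← Real.rpow_sub_one hN.ne']; congr 1; ring
        rw [this]; field_simp

/-- Theorem 5 (ii): if `f ∈ Lip(α,p)`, `p > 1`, `0 < α < 1`, the matrix
is nonnegative, lower triangular with row sums `1`, its rows are in `AMDMS` with a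
constant independent of `n`, and `(n+1)a_{n,0} = O(1)`, then
`‖T_n(f) - f‖_{L^p} = O(n^{-α})`. -/
theorem trig_approx_AMDMS (p α : ℝ) (hp : 1 < p) (hα0 : 0 < α) (hα1 : α < 1)
    (f : ℝ → ℝ) (hf : LipClass α p f)
    (a : ℕ → ℕ → ℝ)
    (hpos : ∀ n k, k ≤ n → 0 ≤ a n k)
    (hzero : ∀ n k, n < k → a n k = 0)
    (hsum : ∀ n, ∑ k ∈ Finset.range (n + 1), a n k = 1)
    (hAMDMS : ∃ K : ℝ, ∀ n l m : ℕ, l ≤ m → m ≤ n → rowMean a n m ≤ K * rowMean a n l)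
    (hO : ∃ C : ℝ, ∀ n : ℕ, ((n : ℝ) + 1) * a n 0 ≤ C) :
    ∃ C : ℝ, ∀ n : ℕ, 1 ≤ n →
      lpNorm p (fun x => matrixMeans a f n x - f x) ≤ C * (n : ℝ) ^ (-α) := by
  have hp0 : 0 < p := by linarith
  have hpi := Real.two_pi_pos
  obtain ⟨B, hB0, hB⟩ := hf.exists_eLpNorm_partialFourierSum_sub_le hp hα0.le hα1
  obtain ⟨M, hM0, hM⟩ := exists_sum_mul_rpow_neg_le hα0.le hα1 hpos hAMDMS hO
  have hfp := hf.memLp hp0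
  refine ⟨((2 * π) ^ (1 / p))⁻¹ * (B * M), fun n hn ↦ ?_⟩
  have hmk (k : ℕ) : MemLp (fun x ↦ a n k * (partialFourierSum f k x - f x))
      (ENNReal.ofReal p) periodMeasure :=
    (((continuous_partialFourierSum hf.2.1 k).memLp_periodMeasure hp0).sub hfp).const_mul _
  have he : (fun x ↦ matrixMeans a f n x - f x) =
      ∑ k ∈ Finset.range (n + 1), fun x ↦ a n k * (partialFourierSum f k x - f x) := by
    funext x
    simp_rw [Finset.sum_apply, mul_sub]
    rw [Finset.sum_sub_distrib, ← Finset.sum_mul, hsum, one_mul, matrixMeans]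
  have hm : MemLp (fun x ↦ matrixMeans a f n x - f x) (ENNReal.ofReal p) periodMeasure := by
    rw [he]
    exact memLp_finsetSum' _ fun k _ ↦ hmk k
  refine (lpNorm_le_iff hp0 hm (by positivity)).mpr ?_
  rw [mul_assoc, mul_inv_cancel_left₀ (by positivity), he]
  calc _ ≤ ∑ k ∈ Finset.range (n + 1),
        eLpNorm (fun x ↦ a n k * (partialFourierSum f k x - f x)) (ENNReal.ofReal p)
          periodMeasure :=
        eLpNorm_sum_le (fun k _ ↦ (hmk k).1) (by simpa using hp.le)
    _ ≤ ∑ k ∈ Finset.range (n + 1),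
        ENNReal.ofReal (B * (a n k * ((k : ℝ) + 1) ^ (-α))) := by
        refine Finset.sum_le_sum fun k hk ↦ ?_
        have ha := hpos n k (Finset.mem_range_succ_iff.mp hk)
        refine (eLpNorm_const_smul (a n k) (fun x ↦ partialFourierSum f k x - f x)
          (ENNReal.ofReal p) periodMeasure).trans_le ?_
        rw [Real.enorm_of_nonneg ha]
        refine (mul_le_mul' le_rfl (hB k)).trans_eq ?_
        rw [← ENNReal.ofReal_mul ha]
        congr 1; ring
    _ = ENNReal.ofReal (B * ∑ k ∈ Finset.range (n + 1), a n k * ((k : ℝ) + 1) ^ (-α)) := by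
        rw [Finset.mul_sum, ENNReal.ofReal_sum_of_nonneg]
        intro k hk
        have ha := hpos n k (Finset.mem_range_succ_iff.mp hk)
        positivity
    _ ≤ ENNReal.ofReal (B * M * (n : ℝ) ^ (-α)) := by
        apply ENNReal.ofReal_le_ofReal
        rw [mul_assoc]
        gcongr
        refine (hM n).trans (mul_le_mul_of_nonneg_left ?_ hM0)
        have : (0 : ℝ) < n := by exact_mod_cast hn
        exact Real.rpow_le_rpow_of_nonpos this (by linarith) (by linarith)
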